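/- arXiv:2201.11537 — 10 statements merged into one kernel-verified Lean document; each statement's English description precedes it below -/
import Mathlib

section
/- Let a < b be reals and let p : [a,b] → [1,∞) be Lebesgue integrable. Then the space WBV_{p(·)}[a,b] is complete with respect to the Luxemburg norm: every sequence (f_j) in WBV_{p(·)}[a,b] that is Cauchy with respect to ‖·‖ converges in the norm ‖·‖ to some function f ∈ WBV_{p(·)}[a,b]. -/
open MeasureTheory Set Filter
open scoped ENNReal

/-- The harmonic mean exponent `p̄([u,v]) = ((v-u)⁻¹ ∫_u^v 1/p)⁻¹`. -/
noncomputable def pbar (p : ℝ → ℝ) (u v : ℝ) : ℝ :=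
  ((v - u)⁻¹ * ∫ t in u..v, (p t)⁻¹)⁻¹

/-- `t 0 = c < t 1 < ⋯ < t n = d` is a partition of `[c,d]`. -/
def IsPartition (c d : ℝ) (n : ℕ) (t : ℕ → ℝ) : Prop :=
  0 < n ∧ t 0 = c ∧ t n = d ∧ ∀ k < n, t k < t (k + 1)

/-- The Wiener variable-exponent variation `V_c^d(p, f)`, valued in `[0,∞]`. -/
noncomputable def wienerVar (p f : ℝ → ℝ) (c d : ℝ) : ℝ≥0∞ :=
  ⨆ (n : ℕ) (t : ℕ → ℝ) (_ : IsPartition c d n t),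
    ENNReal.ofReal (∑ k ∈ Finset.range n,
      |f (t (k + 1)) - f (t k)| ^ pbar p (t k) (t (k + 1)))

/-- The Luxemburg norm `inf {λ > 0 : V_a^b(p, f/λ) ≤ 1}`, valued in `[0,∞]`. -/
noncomputable def luxNorm (p f : ℝ → ℝ) (a b : ℝ) : ℝ≥0∞ :=
  ⨅ (l : ℝ) (_ : 0 < l) (_ : wienerVar p (fun x => f x / l) a b ≤ 1),
    ENNReal.ofReal l

/-- Membership in the space `WBV_{p(·)}[a,b]`. -/
def MemWBV (p f : ℝ → ℝ) (a b : ℝ) : Prop :=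
  f a = 0 ∧ luxNorm p f a b < ⊤

/-- The harmonic mean of an exponent that is at least `1` is at least `1`. -/
theorem one_le_pbar {a b : ℝ} {p : ℝ → ℝ} (hp1 : ∀ x ∈ Icc a b, 1 ≤ p x)
    (hpint : IntegrableOn p (Icc a b)) {u v : ℝ} (hu : a ≤ u) (huv : u < v) (hv : v ≤ b) :
    1 ≤ pbar p u v := by
  have hsub : Icc u v ⊆ Icc a b := Icc_subset_Icc hu hv
  have hle : ∀ x ∈ Icc u v, (p x)⁻¹ ≤ 1 := fun x hx => inv_le_one_of_one_le₀ (hp1 x (hsub hx))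
  have hpos : ∀ x ∈ Icc u v, 0 < (p x)⁻¹ := fun x hx =>
    inv_pos.2 (zero_lt_one.trans_le (hp1 x (hsub hx)))
  have hint : IntegrableOn (fun x => (p x)⁻¹) (Icc u v) := by
    have hmeas : AEStronglyMeasurable (fun x => (p x)⁻¹) (volume.restrict (Icc u v)) :=
      (hpint.mono_set hsub).aestronglyMeasurable.aemeasurable.inv.aestronglyMeasurable
    refine Integrable.mono' (g := fun _ => (1 : ℝ)) (by simp) hmeas ?_
    filter_upwards [ae_restrict_mem measurableSet_Icc] with x hx
    rw [Real.norm_of_nonneg (hpos x hx).le]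
    exact hle x hx
  have hii : IntervalIntegrable (fun x => (p x)⁻¹) volume u v :=
    (intervalIntegrable_iff_integrableOn_Icc_of_le huv.le).2 hint
  have hI : 0 < ∫ t in u..v, (p t)⁻¹ :=
    intervalIntegral.intervalIntegral_pos_of_pos_on hii
      (fun x hx => hpos x (Ioo_subset_Icc_self hx)) huv
  have hI' : ∫ t in u..v, (p t)⁻¹ ≤ v - u := by
    calc ∫ t in u..v, (p t)⁻¹ ≤ ∫ _ in u..v, (1 : ℝ) :=
          intervalIntegral.integral_mono_on huv.le hii (by simp) hle
      _ = v - u := by simp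
  have hvu : 0 < v - u := sub_pos.2 huv
  refine (one_le_inv₀ (by positivity)).2 ?_
  rw [inv_mul_eq_div]
  exact (div_le_one hvu).2 hI'

theorem IsPartition.mem_Icc {c d : ℝ} {n : ℕ} {t : ℕ → ℝ} (ht : IsPartition c d n t)
    {k : ℕ} (hk : k ≤ n) : t k ∈ Icc c d := by
  obtain ⟨-, h0, hn, hlt⟩ := ht
  have hmono : MonotoneOn t (Iic n) := by
    refine monotoneOn_of_le_add_one ordConnected_Iic fun k _ _ hk => (hlt k hk).le
  exact ⟨h0 ▸ hmono (Nat.zero_le n) hk (Nat.zero_le k), hn ▸ hmono hk (le_refl n) hk⟩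

theorem IsPartition.one_le_pbar {a b : ℝ} {p : ℝ → ℝ} (hp1 : ∀ x ∈ Icc a b, 1 ≤ p x)
    (hpint : IntegrableOn p (Icc a b)) {n : ℕ} {t : ℕ → ℝ} (ht : IsPartition a b n t)
    {k : ℕ} (hk : k < n) : 1 ≤ pbar p (t k) (t (k + 1)) :=
  _root_.one_le_pbar hp1 hpint (ht.mem_Icc hk.le).1 (ht.2.2.2 k hk) (ht.mem_Icc hk).2

theorem wienerVar_le_one_iff {p g : ℝ → ℝ} {a b : ℝ} :
    wienerVar p g a b ≤ 1 ↔ ∀ n t, IsPartition a b n t →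
      ∑ k ∈ Finset.range n, |g (t (k + 1)) - g (t k)| ^ pbar p (t k) (t (k + 1)) ≤ 1 := by
  simp only [wienerVar, iSup_le_iff, ENNReal.ofReal_le_one]

theorem luxNorm_le {p g : ℝ → ℝ} {a b l : ℝ} (hl : 0 < l)
    (h : wienerVar p (fun x => g x / l) a b ≤ 1) : luxNorm p g a b ≤ ENNReal.ofReal l :=
  iInf_le_of_le l (iInf_le_of_le hl (iInf_le _ h))

theorem exists_wienerVar_le_one_of_luxNorm_lt {p g : ℝ → ℝ} {a b : ℝ} {r : ℝ≥0∞}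
    (h : luxNorm p g a b < r) :
    ∃ l : ℝ, 0 < l ∧ wienerVar p (fun x => g x / l) a b ≤ 1 ∧ ENNReal.ofReal l < r := by
  simpa only [luxNorm, iInf_lt_iff, exists_prop] using h

section

variable {a b : ℝ} {p : ℝ → ℝ}

theorem wienerVar_div_le_one_of_luxNorm_lt (hp1 : ∀ x ∈ Icc a b, 1 ≤ p x)
    (hpint : IntegrableOn p (Icc a b)) {g : ℝ → ℝ} {ε : ℝ}
    (h : luxNorm p g a b < ENNReal.ofReal ε) :
    wienerVar p (fun x => g x / ε) a b ≤ 1 := by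
  obtain ⟨l, hl, hvar, hlε⟩ := exists_wienerVar_le_one_of_luxNorm_lt h
  have hlε : l < ε := (ENNReal.ofReal_lt_ofReal_iff_of_nonneg hl.le).1 hlε
  rw [wienerVar_le_one_iff] at hvar ⊢
  refine fun n t ht => (Finset.sum_le_sum fun k hk => ?_).trans (hvar n t ht)
  have hq := ht.one_le_pbar hp1 hpint (Finset.mem_range.1 hk)
  refine Real.rpow_le_rpow (abs_nonneg _) ?_ (zero_le_one.trans hq)
  rw [← sub_div, ← sub_div, abs_div, abs_div, abs_of_pos hl, abs_of_pos (hl.trans hlε)]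
  gcongr

theorem abs_sub_le_one_of_wienerVar_le_one (hp1 : ∀ x ∈ Icc a b, 1 ≤ p x)
    (hpint : IntegrableOn p (Icc a b)) {g : ℝ → ℝ} (h : wienerVar p g a b ≤ 1)
    {x : ℝ} (hx : x ∈ Icc a b) : |g x - g a| ≤ 1 := by
  rw [wienerVar_le_one_iff] at h
  rcases hx.1.eq_or_lt with rfl | hax
  · simp
  have hq := one_le_pbar hp1 hpint le_rfl hax hx.2
  suffices |g x - g a| ^ pbar p a x ≤ 1 from
    le_of_not_gt fun hlt => this.not_gt (Real.one_lt_rpow hlt (by linarith))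
  rcases hx.2.eq_or_lt with rfl | hxb
  · simpa using h 1 (fun k => if k = 0 then a else x) ⟨by simp, by simp, by simp, by simp [hax]⟩
  · have := h 2 (fun k => if k = 0 then a else if k = 1 then x else b)
      ⟨by simp, by simp, by simp, fun k hk => by interval_cases k <;> simp [hax, hxb]⟩
    simp only [Finset.sum_range_succ, Finset.sum_range_zero, zero_add] at this
    norm_num at this
    have h2 : 0 ≤ |g b - g x| ^ pbar p x b := by positivity
    linarith

theorem wienerVar_le_one_of_tendsto (hp1 : ∀ x ∈ Icc a b, 1 ≤ p x)
    (hpint : IntegrableOn p (Icc a b)) {G : ℕ → ℝ → ℝ} {g : ℝ → ℝ}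
    (hG : ∀ x ∈ Icc a b, Tendsto (fun m => G m x) atTop (nhds (g x)))
    (h : ∀ᶠ m in atTop, wienerVar p (G m) a b ≤ 1) : wienerVar p g a b ≤ 1 := by
  simp only [wienerVar_le_one_iff] at h ⊢
  intro n t ht
  refine le_of_tendsto (tendsto_finsetSum _ fun k hk => ?_) (h.mono fun m hm => hm n t ht)
  have hk := Finset.mem_range.1 hk
  exact ((hG _ (ht.mem_Icc hk)).sub (hG _ (ht.mem_Icc hk.le))).abs.rpow_const
    (Or.inr (zero_le_one.trans (ht.one_le_pbar hp1 hpint hk)))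

/-- The triangle inequality for the Luxemburg norm, at the level of admissible scalings. -/
theorem wienerVar_add_div_le_one (hp1 : ∀ x ∈ Icc a b, 1 ≤ p x)
    (hpint : IntegrableOn p (Icc a b)) {g h : ℝ → ℝ} {l m : ℝ} (hl : 0 < l) (hm : 0 < m)
    (hg : wienerVar p (fun x => g x / l) a b ≤ 1) (hh : wienerVar p (fun x => h x / m) a b ≤ 1) :
    wienerVar p (fun x => (g x + h x) / (l + m)) a b ≤ 1 := by
  rw [wienerVar_le_one_iff] at *
  intro n t ht
  have hlm : 0 < l + m := add_pos hl hm
  calc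
    _ ≤ ∑ k ∈ Finset.range n,
        (l / (l + m) * |g (t (k + 1)) / l - g (t k) / l| ^ pbar p (t k) (t (k + 1)) +
          m / (l + m) * |h (t (k + 1)) / m - h (t k) / m| ^ pbar p (t k) (t (k + 1))) := by
      refine Finset.sum_le_sum fun k hk => ?_
      have hq := ht.one_le_pbar hp1 hpint (Finset.mem_range.1 hk)
      have hconv := (convexOn_rpow hq).2 (mem_Ici.2 (abs_nonneg (g (t (k + 1)) / l - g (t k) / l)))
        (mem_Ici.2 (abs_nonneg (h (t (k + 1)) / m - h (t k) / m)))
        (div_pos hl hlm).le (div_pos hm hlm).le (by field_simp)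
      simp only [smul_eq_mul] at hconv
      refine le_trans (Real.rpow_le_rpow (abs_nonneg _) ?_ (zero_le_one.trans hq)) hconv
      have hsplit : (g (t (k + 1)) + h (t (k + 1))) / (l + m) - (g (t k) + h (t k)) / (l + m) =
          l / (l + m) * (g (t (k + 1)) / l - g (t k) / l) +
            m / (l + m) * (h (t (k + 1)) / m - h (t k) / m) := by
        field_simp
        ring
      rw [hsplit]
      refine (abs_add_le _ _).trans_eq ?_
      rw [abs_mul, abs_mul, abs_of_pos (div_pos hl hlm), abs_of_pos (div_pos hm hlm)]
    _ ≤ l / (l + m) * 1 + m / (l + m) * 1 := by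
      rw [Finset.sum_add_distrib, ← Finset.mul_sum, ← Finset.mul_sum]
      gcongr
      exacts [hg n t ht, hh n t ht]
    _ = 1 := by field_simp

end

/-- `WBV_{p(·)}[a,b]` is complete with respect to the Luxemburg norm. -/
theorem wbv_complete (a b : ℝ) (hab : a < b) (p : ℝ → ℝ)
    (hp1 : ∀ x ∈ Set.Icc a b, 1 ≤ p x)
    (hpint : MeasureTheory.IntegrableOn p (Set.Icc a b))
    (F : ℕ → ℝ → ℝ) (hF : ∀ j, MemWBV p (F j) a b)
    (hcauchy : ∀ ε : ℝ, 0 < ε → ∃ N : ℕ, ∀ m ≥ N, ∀ n ≥ N,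
      luxNorm p (fun x => F m x - F n x) a b < ENNReal.ofReal ε) :
    ∃ f : ℝ → ℝ, MemWBV p f a b ∧
      ∀ ε : ℝ, 0 < ε → ∃ N : ℕ, ∀ n ≥ N,
        luxNorm p (fun x => F n x - f x) a b < ENNReal.ofReal ε := by
  have hbound : ∀ ε : ℝ, 0 < ε → ∃ N : ℕ, ∀ m ≥ N, ∀ n ≥ N,
      wienerVar p (fun x => (F m x - F n x) / ε) a b ≤ 1 := fun ε hε =>
    (hcauchy ε hε).imp fun N hN m hm n hn =>
      wienerVar_div_le_one_of_luxNorm_lt hp1 hpint (hN m hm n hn)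
  have hlim : ∀ x, ∃ y, x ∈ Icc a b → Tendsto (fun m => F m x) atTop (nhds y) := by
    intro x
    by_cases hx : x ∈ Icc a b
    · have hc : CauchySeq fun m => F m x := by
        refine Metric.cauchySeq_iff.2 fun ε hε => ?_
        obtain ⟨N, hN⟩ := hbound (ε / 2) (half_pos hε)
        refine ⟨N, fun m hm n hn => ?_⟩
        have h := abs_sub_le_one_of_wienerVar_le_one hp1 hpint (hN m hm n hn) hx
        rw [(hF m).1, (hF n).1, sub_self, zero_div, sub_zero, abs_div, abs_of_pos (half_pos hε),
          div_le_one (half_pos hε)] at h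
        rw [Real.dist_eq]
        linarith
      exact (cauchySeq_tendsto_of_complete hc).imp fun y hy _ => hy
    · exact ⟨0, fun h => absurd h hx⟩
  choose f hf using hlim
  have hconv : ∀ ε : ℝ, 0 < ε → ∃ N : ℕ, ∀ n ≥ N,
      wienerVar p (fun x => (F n x - f x) / ε) a b ≤ 1 ∧
        wienerVar p (fun x => (f x - F n x) / ε) a b ≤ 1 := by
    intro ε hε
    obtain ⟨N, hN⟩ := hbound ε hε
    refine ⟨N, fun n hn => ⟨?_, ?_⟩⟩
    · exact wienerVar_le_one_of_tendsto hp1 hpint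
        (fun x hx => ((hf x hx).const_sub (F n x)).div_const ε)
        ((eventually_ge_atTop N).mono fun m hm => hN n hn m hm)
    · exact wienerVar_le_one_of_tendsto hp1 hpint
        (fun x hx => ((hf x hx).sub_const (F n x)).div_const ε)
        ((eventually_ge_atTop N).mono fun m hm => hN m hm n hn)
  refine ⟨f, ⟨?_, ?_⟩, fun ε hε => ?_⟩
  · have h := hf a (left_mem_Icc.2 hab.le)
    simp only [(hF _).1] at h
    exact tendsto_nhds_unique h tendsto_const_nhds
  · obtain ⟨N, hN⟩ := hconv 1 one_pos
    obtain ⟨l, hl, hvar, -⟩ := exists_wienerVar_le_one_of_luxNorm_lt (hF N).2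
    have h := wienerVar_add_div_le_one hp1 hpint hl one_pos hvar (hN N le_rfl).2
    simp only [add_sub_cancel] at h
    exact (luxNorm_le (add_pos hl one_pos) h).trans_lt ENNReal.ofReal_lt_top
  · obtain ⟨N, hN⟩ := hconv (ε / 2) (half_pos hε)
    exact ⟨N, fun n hn => (luxNorm_le (half_pos hε) (hN n hn).1).trans_lt
      ((ENNReal.ofReal_lt_ofReal_iff hε).2 (half_lt_self hε))⟩
end

section
/- Let a < b be reals, let p : [a,b] → [1,∞) be Lebesgue integrable, and let f ∈ WBV_{p(·)}[a,b]. Then f is bounded on [a,b]. -/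
open MeasureTheory Set Filter
open scoped ENNReal

theorem pbar_pos {p : ℝ → ℝ} {u v : ℝ} (huv : u < v) (hp1 : ∀ x ∈ Icc u v, 1 ≤ p x)
    (hpint : IntegrableOn p (Icc u v)) : 0 < pbar p u v := by
  have hint : IntegrableOn (fun t => (p t)⁻¹) (Icc u v) := by
    refine Integrable.of_bound (C := 1)
      hpint.aestronglyMeasurable.aemeasurable.inv.aestronglyMeasurable ?_
    filter_upwards [ae_restrict_mem measurableSet_Icc] with x hx
    have h := hp1 x hx
    rw [Real.norm_of_nonneg (by positivity)]
    exact inv_le_one_of_one_le₀ h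
  have hpos : 0 < ∫ t in u..v, (p t)⁻¹ := by
    refine intervalIntegral.intervalIntegral_pos_of_pos_on
      ((intervalIntegrable_iff_integrableOn_Icc_of_le huv.le).2 hint) (fun x hx => ?_) huv
    have h := hp1 x (Ioo_subset_Icc_self hx)
    positivity
  exact inv_pos.2 (mul_pos (inv_pos.2 (sub_pos.2 huv)) hpos)

theorem exists_isPartition_first_point {a b x : ℝ} (hax : a < x) (hxb : x ≤ b) :
    ∃ (n : ℕ) (t : ℕ → ℝ), IsPartition a b n t ∧ t 1 = x := by
  rcases hxb.eq_or_lt with rfl | hxb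
  · refine ⟨1, fun k => if k = 0 then a else x, ⟨by simp, by simp, by simp, fun k hk => ?_⟩,
      by simp⟩
    interval_cases k
    simpa using hax
  · refine ⟨2, fun k => if k = 0 then a else if k = 1 then x else b,
      ⟨by simp, by simp, by simp, fun k hk => ?_⟩, by simp⟩
    interval_cases k
    · simpa using hax
    · simpa using hxb

theorem abs_sub_le_one_of_wienerVar_le_one_s2 {p g : ℝ → ℝ} {a b x : ℝ} (hax : a < x) (hxb : x ≤ b)
    (hp : 0 < pbar p a x) (hg : wienerVar p g a b ≤ 1) : |g x - g a| ≤ 1 := by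
  obtain ⟨n, t, ht, rfl⟩ := exists_isPartition_first_point hax hxb
  by_contra! hlt
  have hsum := (le_iSup₂_of_le n t (le_iSup_of_le ht le_rfl)).trans hg
  rw [ENNReal.ofReal_le_one] at hsum
  have hfirst := (Finset.single_le_sum (f := fun k =>
    |g (t (k + 1)) - g (t k)| ^ pbar p (t k) (t (k + 1)))
    (fun _ _ => by positivity) (Finset.mem_range.2 ht.1)).trans hsum
  simp only [zero_add, ht.2.1] at hfirst
  exact (Real.one_lt_rpow hlt hp).not_ge hfirst

/-- every `f ∈ WBV_{p(·)}[a,b]` is bounded on `[a,b]`. -/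
theorem wbv_bounded (a b : ℝ) (hab : a < b) (p : ℝ → ℝ)
    (hp1 : ∀ x ∈ Set.Icc a b, 1 ≤ p x)
    (hpint : MeasureTheory.IntegrableOn p (Set.Icc a b))
    (f : ℝ → ℝ) (hf : MemWBV p f a b) :
    ∃ M : ℝ, ∀ x ∈ Set.Icc a b, |f x| ≤ M := by
  obtain ⟨hfa, hlux⟩ := hf
  simp only [luxNorm, iInf_lt_iff] at hlux
  obtain ⟨l, hl, hvar, -⟩ := hlux
  refine ⟨l, fun x hx => ?_⟩
  rcases hx.1.eq_or_lt with rfl | hax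
  · simpa [hfa] using hl.le
  · have hsub : Icc a x ⊆ Icc a b := Icc_subset_Icc_right hx.2
    have h := abs_sub_le_one_of_wienerVar_le_one_s2 hax hx.2
      (pbar_pos hax (fun y hy => hp1 y (hsub hy)) (hpint.mono_set hsub)) hvar
    rwa [hfa, zero_div, sub_zero, abs_div, abs_of_pos hl, div_le_one hl] at h
end

section
/- Let a < b be reals and let p : [a,b] → [1,∞) be measurable and bounded. If f ∈ BV^{p(·)}[a,b], then f ∈ WBV_{p(·)}[a,b]; moreover V_a^b(p,f) ≤ V^{p(·)}_{[a,b]}(f). -/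
open MeasureTheory Set Filter
open scoped ENNReal

/-- The tagged variable-exponent variation `V^{p(·)}_{[a,b]}(f)`, valued in `[0,∞]`. -/
noncomputable def taggedVar (p f : ℝ → ℝ) (a b : ℝ) : ℝ≥0∞ :=
  ⨆ (n : ℕ) (t : ℕ → ℝ) (x : ℕ → ℝ)
    (_ : IsPartition a b n t ∧ ∀ k < n, x k ∈ Set.Icc (t k) (t (k + 1))),
    ENNReal.ofReal (∑ k ∈ Finset.range n,
      |f (t (k + 1)) - f (t k)| ^ p (x k))

/-- Membership in the space `BV^{p(·)}[a,b]`. -/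
def MemBV (p f : ℝ → ℝ) (a b : ℝ) : Prop :=
  f a = 0 ∧ taggedVar p f a b < ⊤

/-- On `[u,v]` the harmonic mean exponent lies between two values of the exponent. -/
theorem exists_le_pbar_and_pbar_le {p : ℝ → ℝ} (hpm : Measurable p) {u v : ℝ} (huv : u < v)
    (hp1 : ∀ x ∈ Set.Icc u v, 1 ≤ p x) :
    (∃ x ∈ Set.Icc u v, p x ≤ pbar p u v) ∧ ∃ x ∈ Set.Icc u v, pbar p u v ≤ p x := by
  have hint : IntegrableOn (fun t => (p t)⁻¹) (Set.Ioc u v) := by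
    refine Measure.integrableOn_of_bounded (M := 1) (by simp) hpm.inv.aestronglyMeasurable ?_
    refine (ae_restrict_iff' measurableSet_Ioc).2 (ae_of_all _ fun t ht => ?_)
    have h1 := hp1 t (Set.Ioc_subset_Icc_self ht)
    rw [Real.norm_of_nonneg (by positivity)]
    exact inv_le_one_of_one_le₀ h1
  have hne : volume (Set.Ioc u v) ≠ 0 := by simpa using huv
  have havg : pbar p u v = (⨍ t in Set.Ioc u v, (p t)⁻¹)⁻¹ := by
    rw [pbar, ← smul_eq_mul (v - u)⁻¹, ← interval_average_eq, uIoc_of_le huv.le]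
  obtain ⟨x, hx, hxle⟩ := exists_le_setAverage hne (by simp) hint
  obtain ⟨y, hy, hyle⟩ := exists_setAverage_le hne (by simp) hint
  have hpx := hp1 x (Set.Ioc_subset_Icc_self hx)
  have hpy := hp1 y (Set.Ioc_subset_Icc_self hy)
  have hx0 : 0 < (p x)⁻¹ := by positivity
  have hpos := hx0.trans_le hxle
  rw [havg]
  refine ⟨⟨y, Set.Ioc_subset_Icc_self hy, ?_⟩, x, Set.Ioc_subset_Icc_self hx, ?_⟩
  · exact (le_inv_comm₀ hpos (by positivity)).1 hyle
  · exact (inv_le_comm₀ (by positivity) hpos).1 hxle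

/-- The harmonic mean of an exponent that is at least `1` is at least `1`. -/
theorem one_le_pbar_s4 {p : ℝ → ℝ} (hpm : Measurable p) {u v : ℝ} (huv : u < v)
    (hp1 : ∀ x ∈ Set.Icc u v, 1 ≤ p x) : 1 ≤ pbar p u v := by
  obtain ⟨x, hx, hle⟩ := (exists_le_pbar_and_pbar_le hpm huv hp1).1
  exact (hp1 x hx).trans hle

/-- A power with the harmonic mean exponent is dominated by one with a suitable tag. -/
theorem exists_rpow_pbar_le {p : ℝ → ℝ} (hpm : Measurable p) {u v : ℝ} (huv : u < v)
    (hp1 : ∀ x ∈ Set.Icc u v, 1 ≤ p x) {d : ℝ} (hd : 0 ≤ d) :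
    ∃ x ∈ Set.Icc u v, d ^ pbar p u v ≤ d ^ p x := by
  obtain ⟨⟨x, hx, hxle⟩, y, hy, hyle⟩ := exists_le_pbar_and_pbar_le hpm huv hp1
  rcases le_total 1 d with h | h
  · exact ⟨y, hy, Real.rpow_le_rpow_of_exponent_le h hyle⟩
  · exact ⟨x, hx, Real.rpow_le_rpow_of_exponent_ge_of_imp hd h hxle
      fun _ h0 => by linarith [hp1 x hx]⟩

/-- The cells of a partition of `[c,d]` are contained in `[c,d]`. -/
theorem IsPartition.Icc_subset {c d : ℝ} {n : ℕ} {t : ℕ → ℝ} (h : IsPartition c d n t)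
    {k : ℕ} (hk : k < n) : Set.Icc (t k) (t (k + 1)) ⊆ Set.Icc c d := by
  obtain ⟨-, rfl, rfl, hlt⟩ := h
  have hmono : MonotoneOn t (Set.Iic n) := by
    refine monotoneOn_of_le_succ Set.ordConnected_Iic fun m _ _ hm => ?_
    exact (hlt m (Nat.lt_of_succ_le hm)).le
  exact Set.Icc_subset_Icc (hmono (Nat.zero_le n) hk.le (Nat.zero_le k))
    (hmono (Nat.succ_le_of_lt hk) (le_refl n) (Nat.succ_le_of_lt hk))

theorem wienerVar_le_taggedVar {a b : ℝ} {p : ℝ → ℝ} (hpm : Measurable p)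
    (hp1 : ∀ x ∈ Set.Icc a b, 1 ≤ p x) (f : ℝ → ℝ) :
    wienerVar p f a b ≤ taggedVar p f a b := by
  refine iSup_le fun n => iSup₂_le fun t ht => ?_
  have key : ∀ k, ∃ x, k < n → x ∈ Set.Icc (t k) (t (k + 1)) ∧
      |f (t (k + 1)) - f (t k)| ^ pbar p (t k) (t (k + 1)) ≤
        |f (t (k + 1)) - f (t k)| ^ p x := by
    intro k
    by_cases hk : k < n
    · obtain ⟨x, hx, hle⟩ := exists_rpow_pbar_le hpm (ht.2.2.2 k hk)
        (fun x hx => hp1 x (ht.Icc_subset hk hx)) (abs_nonneg (f (t (k + 1)) - f (t k)))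
      exact ⟨x, fun _ => ⟨hx, hle⟩⟩
    · exact ⟨0, fun h => absurd h hk⟩
  choose x hx using key
  refine le_trans (ENNReal.ofReal_le_ofReal
    (Finset.sum_le_sum fun k hk => (hx k (Finset.mem_range.1 hk)).2)) ?_
  exact le_iSup_of_le n <| le_iSup_of_le t <| le_iSup_of_le x <|
    le_iSup_of_le ⟨ht, fun k hk => (hx k hk).1⟩ le_rfl

/-- Dividing a function by `l ≥ 1` divides its Wiener variation by at least `l`. -/
theorem wienerVar_div_le {a b : ℝ} {p : ℝ → ℝ} (hpm : Measurable p)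
    (hp1 : ∀ x ∈ Set.Icc a b, 1 ≤ p x) (f : ℝ → ℝ) {l : ℝ} (hl : 1 ≤ l) :
    wienerVar p (fun x => f x / l) a b ≤ ENNReal.ofReal l⁻¹ * wienerVar p f a b := by
  refine iSup_le fun n => iSup₂_le fun t ht => ?_
  have hl0 : 0 ≤ l⁻¹ := by positivity
  have hle : ∑ k ∈ Finset.range n,
      |f (t (k + 1)) / l - f (t k) / l| ^ pbar p (t k) (t (k + 1)) ≤
      l⁻¹ * ∑ k ∈ Finset.range n,
        |f (t (k + 1)) - f (t k)| ^ pbar p (t k) (t (k + 1)) := by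
    rw [Finset.mul_sum]
    refine Finset.sum_le_sum fun k hk => ?_
    rw [Finset.mem_range] at hk
    have h1 := one_le_pbar_s4 hpm (ht.2.2.2 k hk) fun x hx => hp1 x (ht.Icc_subset hk hx)
    rw [← sub_div, div_eq_inv_mul, abs_mul, abs_of_nonneg hl0,
      Real.mul_rpow hl0 (abs_nonneg _)]
    gcongr
    exact Real.rpow_le_self_of_le_one hl0 (inv_le_one_of_one_le₀ hl) h1
  refine (ENNReal.ofReal_le_ofReal hle).trans ?_
  rw [ENNReal.ofReal_mul hl0]
  gcongr
  exact le_iSup_of_le n <| le_iSup₂_of_le t ht le_rfl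

/-- Finite Wiener variation implies finite Luxemburg norm. -/
theorem luxNorm_lt_top_of_wienerVar_lt_top {a b : ℝ} {p : ℝ → ℝ} (hpm : Measurable p)
    (hp1 : ∀ x ∈ Set.Icc a b, 1 ≤ p x) {f : ℝ → ℝ} (hf : wienerVar p f a b < ⊤) :
    luxNorm p f a b < ⊤ := by
  set l : ℝ := max 1 (wienerVar p f a b).toReal
  have hl1 : 1 ≤ l := le_max_left _ _
  have hl : 0 < l := one_pos.trans_le hl1
  have hle : wienerVar p (fun x => f x / l) a b ≤ 1 := by
    refine (wienerVar_div_le hpm hp1 f hl1).trans ?_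
    rw [← ENNReal.ofReal_toReal hf.ne, ← ENNReal.ofReal_mul (by positivity),
      ENNReal.ofReal_le_one, inv_mul_le_one₀ hl]
    exact le_max_right _ _
  exact (iInf_le_of_le l <| iInf₂_le_of_le hl hle le_rfl).trans_lt ENNReal.ofReal_lt_top

/-- for bounded measurable exponents, `BV^{p(·)}[a,b] ⊆ WBV_{p(·)}[a,b]`
and `V_a^b(p,f) ≤ V^{p(·)}_{[a,b]}(f)`. -/
theorem bv_subset_wbv (a b : ℝ) (hab : a < b) (p : ℝ → ℝ)
    (hpm : Measurable p)
    (hp1 : ∀ x ∈ Set.Icc a b, 1 ≤ p x)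
    (hpbd : ∃ M : ℝ, ∀ x ∈ Set.Icc a b, p x ≤ M)
    (f : ℝ → ℝ) (hf : MemBV p f a b) :
    MemWBV p f a b ∧ wienerVar p f a b ≤ taggedVar p f a b := by
  have hle := wienerVar_le_taggedVar hpm hp1 f
  exact ⟨⟨hf.1, luxNorm_lt_top_of_wienerVar_lt_top hpm hp1 (hle.trans_lt hf.2)⟩, hle⟩
end

section
/- There exist a bounded measurable exponent p : [0,1] → [1,∞) and a function f : [0,1] → ℝ with f(0) = 0 such that V_0^1(p,f) < ∞ (so f ∈ WBV_{p(·)}[0,1]) while the tagged variation V^{p(·)}_{[0,1]}(f) = ∞ (so f ∉ BV^{p(·)}[0,1]). -/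
open MeasureTheory Set Filter
open scoped ENNReal

/-- The exponent that equals `1` at the rationals and `2` elsewhere. -/
noncomputable def ratExponent (x : ℝ) : ℝ :=
  2 - (range ((↑) : ℚ → ℝ)).indicator 1 x

/-- The function equal to `1 / j` at `1 / j` for even `j`, and to `0` elsewhere. -/
noncomputable def evenSpikes : ℝ → ℝ :=
  Function.extend (fun j : ℕ => (j : ℝ)⁻¹) (fun j => if Even j then (j : ℝ)⁻¹ else 0) 0

lemma measurable_ratExponent : Measurable ratExponent :=
  measurable_const.sub (measurable_one.indicator (countable_range _).measurableSet)

lemma ratExponent_ratCast (q : ℚ) : ratExponent q = 1 := by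
  rw [ratExponent, indicator_of_mem (mem_range_self q), Pi.one_apply]
  norm_num

lemma ratExponent_eq_one_or_two (x : ℝ) : ratExponent x = 1 ∨ ratExponent x = 2 := by
  by_cases h : x ∈ range ((↑) : ℚ → ℝ)
  · obtain ⟨q, rfl⟩ := h
    exact Or.inl (ratExponent_ratCast q)
  · exact Or.inr (by rw [ratExponent, indicator_of_notMem h, sub_zero])

lemma pbar_ratExponent {u v : ℝ} (h : u < v) : pbar ratExponent u v = 2 := by
  have h_ae : ∀ᵐ x : ℝ, (ratExponent x)⁻¹ = 2⁻¹ := by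
    filter_upwards [(countable_range ((↑) : ℚ → ℝ)).ae_notMem volume] with x hx
    rw [ratExponent, indicator_of_notMem hx, sub_zero]
  have h_int : ∫ t in u..v, (ratExponent t)⁻¹ = ∫ _ in u..v, (2 : ℝ)⁻¹ :=
    intervalIntegral.integral_congr_ae (h_ae.mono fun _ hx _ => hx)
  have h_pos : v - u ≠ 0 := sub_ne_zero.2 h.ne'
  rw [pbar, h_int, intervalIntegral.integral_const, smul_eq_mul, inv_mul_cancel_left₀ h_pos,
    inv_inv]

lemma natCast_inv_injective : Function.Injective (fun j : ℕ => (j : ℝ)⁻¹) :=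
  inv_injective.comp Nat.cast_injective

lemma evenSpikes_inv (j : ℕ) :
    evenSpikes (j : ℝ)⁻¹ = if Even j then (j : ℝ)⁻¹ else 0 :=
  natCast_inv_injective.extend_apply _ _ j

lemma evenSpikes_zero : evenSpikes 0 = 0 := by
  simpa using evenSpikes_inv 0

lemma evenSpikes_of_notMem {x : ℝ} (hx : x ∉ range (fun j : ℕ => (j : ℝ)⁻¹)) :
    evenSpikes x = 0 :=
  Function.extend_apply' _ _ _ hx

lemma evenSpikes_nonneg (x : ℝ) : 0 ≤ evenSpikes x := by
  by_cases hx : x ∈ range (fun j : ℕ => (j : ℝ)⁻¹)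
  · obtain ⟨j, rfl⟩ := hx
    simp only [evenSpikes_inv]
    split_ifs <;> positivity
  · rw [evenSpikes_of_notMem hx]

lemma summable_evenSpikes_sq : Summable (fun x => evenSpikes x ^ 2) := by
  refine (natCast_inv_injective.summable_iff fun x hx => ?_).1 ?_
  · simp [evenSpikes_of_notMem hx]
  · refine Summable.of_nonneg_of_le (fun _ => sq_nonneg _) (fun j => ?_)
      (Real.summable_nat_pow_inv.2 one_lt_two)
    simp only [Function.comp_apply, evenSpikes_inv]
    split_ifs
    · rw [inv_pow]
    · simp

lemma IsPartition.injOn {c d : ℝ} {n : ℕ} {t : ℕ → ℝ} (h : IsPartition c d n t) :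
    InjOn t (Iic n) := by
  have h_mono : StrictMonoOn t (Iic n) :=
    strictMonoOn_Iic_of_lt_succ fun k hk => h.2.2.2 k hk
  exact h_mono.injOn

lemma IsPartition.sum_comp_le_tsum {c d : ℝ} {n : ℕ} {t : ℕ → ℝ} (h : IsPartition c d n t)
    {F : ℝ → ℝ} (hF : ∀ x, 0 ≤ F x) (hs : Summable F) {g : ℕ → ℕ} (hg : Function.Injective g)
    (hgn : ∀ k < n, g k ≤ n) : ∑ k ∈ Finset.range n, F (t (g k)) ≤ ∑' x, F x := by
  classical
  rw [← Finset.sum_image (s := Finset.range n) (g := fun k => t (g k)) (f := F)]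
  · exact hs.sum_le_tsum _ fun x _ => hF x
  · intro i hi j hj hij
    simp only [Finset.coe_range, mem_Iio] at hi hj
    exact hg (h.injOn (hgn i hi) (hgn j hj) hij)

lemma wienerVar_evenSpikes_lt_top : wienerVar ratExponent evenSpikes 0 1 < ⊤ := by
  set S := ∑' x, evenSpikes x ^ 2
  refine lt_of_le_of_lt (b := ENNReal.ofReal (S + S)) ?_ ENNReal.ofReal_lt_top
  refine iSup_le fun n => iSup_le fun t => iSup_le fun ht => ENNReal.ofReal_le_ofReal ?_
  calc ∑ k ∈ Finset.range n,
        |evenSpikes (t (k + 1)) - evenSpikes (t k)| ^ pbar ratExponent (t k) (t (k + 1))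
      ≤ ∑ k ∈ Finset.range n, (evenSpikes (t (k + 1)) ^ 2 + evenSpikes (t k) ^ 2) := by
        refine Finset.sum_le_sum fun k hk => ?_
        rw [pbar_ratExponent (ht.2.2.2 k (Finset.mem_range.1 hk)), Real.rpow_two, sq_abs]
        nlinarith [mul_nonneg (evenSpikes_nonneg (t (k + 1))) (evenSpikes_nonneg (t k))]
    _ ≤ S + S := by
        rw [Finset.sum_add_distrib]
        exact add_le_add
          (ht.sum_comp_le_tsum (F := fun x => evenSpikes x ^ 2) (fun _ => sq_nonneg _)
            summable_evenSpikes_sq (g := fun k => k + 1) (add_left_injective 1) fun k hk => hk)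
          (ht.sum_comp_le_tsum (F := fun x => evenSpikes x ^ 2) (fun _ => sq_nonneg _)
            summable_evenSpikes_sq (g := id) Function.injective_id fun k hk => hk.le)

/-- The points `0 < 1/(m+1) < 1/m < ⋯ < 1/2 < 1`. -/
noncomputable def invPartition (m k : ℕ) : ℝ :=
  if k = 0 then 0 else ((m + 2 - k : ℕ) : ℝ)⁻¹

lemma isPartition_invPartition (m : ℕ) : IsPartition 0 1 (m + 1) (invPartition m) := by
  refine ⟨m.succ_pos, by simp [invPartition], by simp [invPartition], fun k hk => ?_⟩
  have h_pos : (0 : ℝ) < ((m + 2 - (k + 1) : ℕ) : ℝ) := by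
    exact_mod_cast (by omega : 0 < m + 2 - (k + 1))
  rcases Nat.eq_zero_or_pos k with rfl | h
  · simp only [invPartition, if_true, if_neg (Nat.succ_ne_zero _)]
    positivity
  · simp only [invPartition, if_neg h.ne', if_neg (Nat.succ_ne_zero _)]
    refine inv_strictAnti₀ h_pos ?_
    exact_mod_cast (by omega : m + 2 - (k + 1) < m + 2 - k)

lemma ratExponent_invPartition (m k : ℕ) : ratExponent (invPartition m k) = 1 := by
  convert ratExponent_ratCast (if k = 0 then 0 else ((m + 2 - k : ℕ) : ℚ)⁻¹) using 2
  rw [invPartition]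
  split_ifs <;> simp

lemma inv_le_abs_evenSpikes_sub {j : ℕ} (hj : 0 < j) :
    ((j + 1 : ℕ) : ℝ)⁻¹ ≤ |evenSpikes (j : ℝ)⁻¹ - evenSpikes ((j + 1 : ℕ) : ℝ)⁻¹| := by
  have h_pos : (0 : ℝ) < j := by exact_mod_cast hj
  rw [evenSpikes_inv, evenSpikes_inv]
  by_cases h : Even j
  · rw [if_pos h, if_neg (by simpa [Nat.even_add_one] using h), sub_zero, abs_of_pos (by positivity)]
    exact inv_anti₀ h_pos (by simp)
  · rw [if_neg h, if_pos (by simpa [Nat.even_add_one] using h), zero_sub, abs_neg]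
    exact le_abs_self _

lemma harmonic_sum_le_sum_abs_sub (m : ℕ) :
    ∑ i ∈ Finset.range (m + 1), 1 / ((i : ℝ) + 1) - 1 ≤ ∑ k ∈ Finset.range (m + 1),
      |evenSpikes (invPartition m (k + 1)) - evenSpikes (invPartition m k)| := by
  rw [Finset.sum_range_succ', Finset.sum_range_succ' (fun k => |_|),
    ← Finset.sum_range_reflect]
  simp only [Nat.cast_zero, zero_add, div_one, add_sub_cancel_right]
  refine le_add_of_le_of_nonneg (Finset.sum_le_sum fun k hk => ?_) (abs_nonneg _)
  have hk' := Finset.mem_range.1 hk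
  have h := inv_le_abs_evenSpikes_sub (j := m - k) (by omega)
  simp only [invPartition, if_neg (Nat.succ_ne_zero _)]
  rw [show m + 2 - (k + 1 + 1) = m - k by omega, show m + 2 - (k + 1) = m - k + 1 by omega]
  rwa [one_div, ← Nat.cast_add_one, show m - 1 - k + 1 + 1 = m - k + 1 by omega]

lemma taggedVar_evenSpikes_eq_top : taggedVar ratExponent evenSpikes 0 1 = ⊤ := by
  have h_lim : Tendsto (fun m : ℕ => ENNReal.ofReal
      (∑ i ∈ Finset.range (m + 1), 1 / ((i : ℝ) + 1) - 1)) atTop (nhds ⊤) :=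
    ENNReal.tendsto_ofReal_atTop.comp (tendsto_atTop_add_const_right _ (-1 : ℝ)
      (Real.tendsto_sum_range_one_div_nat_succ_atTop.comp (tendsto_add_atTop_nat 1)))
  refine top_le_iff.1 (le_of_tendsto' h_lim fun m => ?_)
  have h_part := isPartition_invPartition m
  refine le_iSup_of_le (m + 1) (le_iSup_of_le (invPartition m)
    (le_iSup_of_le (invPartition m) (le_iSup_of_le
      ⟨h_part, fun k hk => left_mem_Icc.2 (h_part.2.2.2 k hk).le⟩
      (ENNReal.ofReal_le_ofReal ?_))))
  simpa only [ratExponent_invPartition, Real.rpow_one] using harmonic_sum_le_sum_abs_sub m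

/-- there are a bounded measurable exponent `p` and `f` with `f 0 = 0`,
finite Wiener variation but infinite tagged variation on `[0,1]`. -/
theorem exists_wbv_not_bv :
    ∃ p f : ℝ → ℝ, Measurable p ∧
      (∀ x ∈ Set.Icc (0 : ℝ) 1, 1 ≤ p x) ∧
      (∃ M : ℝ, ∀ x ∈ Set.Icc (0 : ℝ) 1, p x ≤ M) ∧
      f 0 = 0 ∧ wienerVar p f 0 1 < ⊤ ∧ taggedVar p f 0 1 = ⊤ := by
  exact ⟨ratExponent, evenSpikes, measurable_ratExponent,
    fun x _ => by rcases ratExponent_eq_one_or_two x with h | h <;> norm_num [h],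
    ⟨2, fun x _ => by rcases ratExponent_eq_one_or_two x with h | h <;> norm_num [h]⟩,
    evenSpikes_zero, wienerVar_evenSpikes_lt_top, taggedVar_evenSpikes_eq_top⟩
end

section
/- Let a < b be reals, let p : [a,b] → [1,∞) be Lebesgue integrable and essentially bounded (esssup_{[a,b]} p < ∞), and let f ∈ WBV_{p(·)}[a,b]. Then for every x ∈ (a,b] the left-hand limit lim_{t→x⁻} f(t) exists and is finite, and for every x ∈ [a,b) the right-hand limit lim_{t→x⁺} f(t) exists and is finite. -/
open MeasureTheory Set Filter
open scoped ENNReal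

/-- Some partition of `[c,d]` has variation sum at least `r`. -/
def HasVarSum (p f : ℝ → ℝ) (c d r : ℝ) : Prop :=
  ∃ (n : ℕ) (t : ℕ → ℝ), IsPartition c d n t ∧
    r ≤ ∑ k ∈ Finset.range n, |f (t (k + 1)) - f (t k)| ^ pbar p (t k) (t (k + 1))

lemma hasVarSum_zero (p f : ℝ → ℝ) {c d : ℝ} (h : c < d) : HasVarSum p f c d 0 := by
  refine ⟨1, fun k => if k = 0 then c else d, ⟨one_pos, by simp, by simp, ?_⟩, ?_⟩
  · intro k hk
    obtain rfl : k = 0 := by omega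
    simpa using h
  · exact Finset.sum_nonneg fun k _ => Real.rpow_nonneg (abs_nonneg _) _

lemma HasVarSum.append {p f : ℝ → ℝ} {c d e r : ℝ} (h : HasVarSum p f c d r) (hde : d < e) :
    HasVarSum p f c e (r + |f e - f d| ^ pbar p d e) := by
  obtain ⟨n, t, ⟨hn, h0, h1, hlt⟩, hr⟩ := h
  refine ⟨n + 1, fun k => if k ≤ n then t k else e, ⟨by omega, by simp [h0], by simp, ?_⟩, ?_⟩
  · intro k hk
    rcases Nat.lt_succ_iff_lt_or_eq.1 hk with h | rfl
    · simpa [h.le, Nat.succ_le_of_lt h] using hlt k h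
    · simpa [h1] using hde
  · rw [Finset.sum_range_succ]
    refine add_le_add (hr.trans (le_of_eq (Finset.sum_congr rfl fun k hk => ?_))) ?_
    · have h := Finset.mem_range.1 hk
      simp [h.le, Nat.succ_le_of_lt h]
    · simp [h1]

lemma HasVarSum.prepend {p f : ℝ → ℝ} {c d e r : ℝ} (h : HasVarSum p f d e r) (hcd : c < d) :
    HasVarSum p f c e (r + |f d - f c| ^ pbar p c d) := by
  obtain ⟨n, t, ⟨hn, h0, h1, hlt⟩, hr⟩ := h
  refine ⟨n + 1, fun k => if k = 0 then c else t (k - 1),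
    ⟨by omega, by simp, by simp [h1], ?_⟩, ?_⟩
  · intro k hk
    rcases k with _ | k
    · simpa [h0] using hcd
    · simpa using hlt k (by omega)
  · rw [Finset.sum_range_succ']
    simpa [h0] using hr

lemma HasVarSum.mono {p f : ℝ → ℝ} {c d r s : ℝ} (h : HasVarSum p f c d r) (hs : s ≤ r) :
    HasVarSum p f c d s := by
  obtain ⟨n, t, ht, hr⟩ := h
  exact ⟨n, t, ht, hs.trans hr⟩

lemma HasVarSum.le_wienerVar {p f : ℝ → ℝ} {c d r : ℝ} (h : HasVarSum p f c d r) :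
    ENNReal.ofReal r ≤ wienerVar p f c d := by
  obtain ⟨n, t, ht, hr⟩ := h
  exact (ENNReal.ofReal_le_ofReal hr).trans
    (le_iSup_of_le n (le_iSup_of_le t (le_iSup_of_le ht le_rfl)))

lemma pbar_mem_Icc {a b M : ℝ} {p : ℝ → ℝ} (hp1 : ∀ x ∈ Icc a b, 1 ≤ p x)
    (hpint : IntegrableOn p (Icc a b)) (hM : 0 < M)
    (hpM : ∀ᵐ x ∂(volume.restrict (Icc a b)), p x ≤ M)
    {u v : ℝ} (hau : a ≤ u) (huv : u < v) (hvb : v ≤ b) : pbar p u v ∈ Icc 0 M := by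
  have hsub : Icc u v ⊆ Icc a b := Icc_subset_Icc hau hvb
  have hpinv : IntegrableOn (fun t => (p t)⁻¹) (Icc u v) := by
    refine (integrable_const (1 : ℝ)).mono'
      (hpint.mono_set hsub).aestronglyMeasurable.aemeasurable.inv.aestronglyMeasurable ?_
    filter_upwards [ae_restrict_mem measurableSet_Icc] with x hx
    have h := hp1 x (hsub hx)
    rw [Real.norm_of_nonneg (by positivity)]
    exact inv_le_one_of_one_le₀ h
  have hint : (v - u) * M⁻¹ ≤ ∫ t in u..v, (p t)⁻¹ := by
    have h := intervalIntegral.integral_mono_ae_restrict (μ := volume) huv.le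
      (f := fun _ => M⁻¹) (g := fun t => (p t)⁻¹) (by simp)
      ((intervalIntegrable_iff_integrableOn_Icc_of_le huv.le).2 hpinv) (by
        filter_upwards [ae_restrict_mem measurableSet_Icc,
          ae_restrict_of_ae_restrict_of_subset hsub hpM] with x hx hxM
        exact inv_anti₀ (by linarith [hp1 x (hsub hx)]) hxM)
    simpa using h
  have hvu : 0 < v - u := sub_pos.2 huv
  have havg : M⁻¹ ≤ (v - u)⁻¹ * ∫ t in u..v, (p t)⁻¹ := by
    rw [inv_mul_eq_div, le_div_iff₀ hvu]
    linarith
  have hpos : 0 < M⁻¹ := inv_pos.2 hM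
  exact ⟨inv_nonneg.2 (hpos.le.trans havg), inv_le_of_inv_le₀ hM havg⟩

/-- If every increment of size at least `ε` contributes at least `η > 0` to a bounded Wiener
variation, then all increments near a point on its left side are smaller than `ε`. -/
lemma exists_osc_lt_left {p g : ℝ → ℝ} {a b x ε η : ℝ} (hx : x ∈ Ioc a b)
    (hV : wienerVar p g a b ≤ 1) (hη : 0 < η)
    (hlow : ∀ u v, a ≤ u → u < v → v ≤ b → ε ≤ |g v - g u| → η ≤ |g v - g u| ^ pbar p u v) :
    ∃ d ∈ Ioo a x, ∀ u v, d < u → u < v → v < x → |g v - g u| < ε := by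
  by_contra! hcon
  have key : ∀ n : ℕ, ∃ d ∈ Ioo a x, HasVarSum p g a d (n * η) := by
    intro n
    induction n with
    | zero =>
      obtain ⟨d, hd⟩ := exists_between hx.1
      exact ⟨d, hd, by simpa using hasVarSum_zero p g hd.1⟩
    | succ n ih =>
      obtain ⟨d, hd, hs⟩ := ih
      obtain ⟨u, v, hdu, huv, hvx, hosc⟩ := hcon d hd
      have hau : a < u := hd.1.trans hdu
      refine ⟨v, ⟨hau.trans huv, hvx⟩, ((hs.append hdu).append huv).mono ?_⟩
      have h1 := hlow u v hau.le huv (hvx.le.trans hx.2) hosc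
      have h2 := Real.rpow_nonneg (abs_nonneg (g u - g d)) (pbar p d u)
      push_cast
      linarith
  obtain ⟨n, hn⟩ := exists_nat_gt (1 / η)
  obtain ⟨d, hd, hs⟩ := key n
  have h := (hs.append (hd.2.trans_le hx.2)).le_wienerVar.trans hV
  rw [ENNReal.ofReal_le_one] at h
  have h2 := Real.rpow_nonneg (abs_nonneg (g b - g d)) (pbar p d b)
  rw [div_lt_iff₀ hη] at hn
  linarith

/-- If every increment of size at least `ε` contributes at least `η > 0` to a bounded Wiener
variation, then all increments near a point on its right side are smaller than `ε`. -/
lemma exists_osc_lt_right {p g : ℝ → ℝ} {a b x ε η : ℝ} (hx : x ∈ Ico a b)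
    (hV : wienerVar p g a b ≤ 1) (hη : 0 < η)
    (hlow : ∀ u v, a ≤ u → u < v → v ≤ b → ε ≤ |g v - g u| → η ≤ |g v - g u| ^ pbar p u v) :
    ∃ d ∈ Ioo x b, ∀ u v, x < u → u < v → v < d → |g v - g u| < ε := by
  by_contra! hcon
  have key : ∀ n : ℕ, ∃ d ∈ Ioo x b, HasVarSum p g d b (n * η) := by
    intro n
    induction n with
    | zero =>
      obtain ⟨d, hd⟩ := exists_between hx.2
      exact ⟨d, hd, by simpa using hasVarSum_zero p g hd.2⟩
    | succ n ih =>
      obtain ⟨d, hd, hs⟩ := ih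
      obtain ⟨u, v, hxu, huv, hvd, hosc⟩ := hcon d hd
      have hvb : v < b := hvd.trans hd.2
      refine ⟨u, ⟨hxu, huv.trans hvb⟩, ((hs.prepend hvd).prepend huv).mono ?_⟩
      have h1 := hlow u v (hx.1.trans hxu.le) huv hvb.le hosc
      have h2 := Real.rpow_nonneg (abs_nonneg (g d - g v)) (pbar p v d)
      push_cast
      linarith
  obtain ⟨n, hn⟩ := exists_nat_gt (1 / η)
  obtain ⟨d, hd, hs⟩ := key n
  have h := (hs.prepend (hx.1.trans_lt hd.1)).le_wienerVar.trans hV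
  rw [ENNReal.ofReal_le_one] at h
  have h2 := Real.rpow_nonneg (abs_nonneg (g d - g a)) (pbar p a d)
  rw [div_lt_iff₀ hη] at hn
  linarith

lemma exists_tendsto_of_osc {l : Filter ℝ} [l.NeBot] {f : ℝ → ℝ}
    (h : ∀ ε > 0, ∃ s ∈ l, ∀ u ∈ s, ∀ v ∈ s, u < v → |f v - f u| < ε) :
    ∃ L, Tendsto f l (nhds L) := by
  refine cauchy_map_iff_exists_tendsto.1 (Metric.cauchy_iff.2 ⟨inferInstance, fun ε hε => ?_⟩)
  obtain ⟨s, hs, hosc⟩ := h ε hε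
  refine ⟨f '' s, image_mem_map hs, ?_⟩
  rintro _ ⟨u, hu, rfl⟩ _ ⟨v, hv, rfl⟩
  rcases lt_trichotomy u v with h | rfl | h
  · rw [dist_comm]
    exact hosc u hu v hv h
  · simpa using hε
  · exact hosc v hv u hu h

/-- for essentially bounded exponents, every `f ∈ WBV_{p(·)}[a,b]` has
finite one-sided limits at every point. -/
theorem wbv_one_sided_limits (a b : ℝ) (hab : a < b) (p : ℝ → ℝ)
    (hp1 : ∀ x ∈ Set.Icc a b, 1 ≤ p x)
    (hpint : MeasureTheory.IntegrableOn p (Set.Icc a b))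
    (hesssup : ∃ M : ℝ, ∀ᵐ x ∂(volume.restrict (Set.Icc a b)), p x ≤ M)
    (f : ℝ → ℝ) (hf : MemWBV p f a b) :
    (∀ x ∈ Set.Ioc a b, ∃ L : ℝ,
      Filter.Tendsto f (nhdsWithin x (Set.Ico a x)) (nhds L)) ∧
    (∀ x ∈ Set.Ico a b, ∃ L : ℝ,
      Filter.Tendsto f (nhdsWithin x (Set.Ioc x b)) (nhds L)) := by
  obtain ⟨M₀, hM₀⟩ := hesssup
  obtain ⟨M, hM, hpM⟩ : ∃ M : ℝ, 0 < M ∧ ∀ᵐ x ∂(volume.restrict (Icc a b)), p x ≤ M :=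
    ⟨max M₀ 1, by positivity, hM₀.mono fun x hx => hx.trans (le_max_left _ _)⟩
  obtain ⟨l, hl, hV⟩ : ∃ l : ℝ, 0 < l ∧ wienerVar p (fun x => f x / l) a b ≤ 1 := by
    have h := hf.2
    simp only [luxNorm, iInf_lt_iff] at h
    obtain ⟨l, hl, hV, -⟩ := h
    exact ⟨l, hl, hV⟩
  have hscale : ∀ ε u v : ℝ, |f v / l - f u / l| < ε / l ↔ |f v - f u| < ε := fun ε u v => by
    rw [← sub_div, abs_div, abs_of_pos hl, div_lt_div_iff_of_pos_right hl]
  have hlow : ∀ ε > 0, ∃ η : ℝ, 0 < η ∧ ∀ u v, a ≤ u → u < v → v ≤ b →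
      ε / l ≤ |f v / l - f u / l| → η ≤ |f v / l - f u / l| ^ pbar p u v := by
    intro ε hε
    have hδ : 0 < min (ε / l) 1 := lt_min (div_pos hε hl) one_pos
    refine ⟨min (ε / l) 1 ^ M, Real.rpow_pos_of_pos hδ _, fun u v hau huv hvb h => ?_⟩
    obtain ⟨h0, h1⟩ := pbar_mem_Icc hp1 hpint hM hpM hau huv hvb
    exact (Real.rpow_le_rpow_of_exponent_ge hδ (min_le_right _ _) h1).trans
      (Real.rpow_le_rpow hδ.le ((min_le_left _ _).trans h) h0)
  refine ⟨fun x hx => ?_, fun x hx => ?_⟩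
  · rw [nhdsWithin_Ico_eq_nhdsLT hx.1]
    refine exists_tendsto_of_osc fun ε hε => ?_
    obtain ⟨η, hη, h⟩ := hlow ε hε
    obtain ⟨d, hd, hosc⟩ := exists_osc_lt_left hx hV hη h
    exact ⟨Ioo d x, Ioo_mem_nhdsLT hd.2, fun u hu v hv huv =>
      (hscale ε u v).1 (hosc u v hu.1 huv hv.2)⟩
  · rw [nhdsWithin_Ioc_eq_nhdsGT hx.2]
    refine exists_tendsto_of_osc fun ε hε => ?_
    obtain ⟨η, hη, h⟩ := hlow ε hε
    obtain ⟨d, hd, hosc⟩ := exists_osc_lt_right hx hV hη h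
    exact ⟨Ioo x d, Ioo_mem_nhdsGT hd.1, fun u hu v hv huv =>
      (hscale ε u v).1 (hosc u v hu.1 huv hv.2)⟩
end

section
/- There exist a Lebesgue integrable, essentially unbounded exponent p : [0,1] → [1,∞) (i.e. esssup_{[0,1]} p = ∞) and a function f ∈ WBV_{p(·)}[0,1] such that the right-hand limit lim_{t→0⁺} f(t) does not exist. -/
open MeasureTheory Set Filter
open scoped ENNReal

lemma IsPartition.le_of_le {c d : ℝ} {n : ℕ} {t : ℕ → ℝ} (h : IsPartition c d n t) {j k : ℕ}
    (hjk : j ≤ k) (hk : k ≤ n) : t j ≤ t k := by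
  induction k, hjk using Nat.le_induction with
  | base => exact le_rfl
  | succ m _ ih => exact (ih (by omega)).trans (h.2.2.2 m (by omega)).le

/-- If every summand is dominated by the length of its interval, the variation is at most the
length of the whole interval. -/
lemma wienerVar_le_of_forall_le_sub {p f : ℝ → ℝ} {c d : ℝ}
    (h : ∀ u v, c ≤ u → u < v → v ≤ d → |f v - f u| ^ pbar p u v ≤ v - u) :
    wienerVar p f c d ≤ ENNReal.ofReal (d - c) := by
  refine iSup_le fun n => iSup_le fun t => iSup_le fun ht => ENNReal.ofReal_le_ofReal ?_
  calc _ ≤ ∑ k ∈ Finset.range n, (t (k + 1) - t k) := Finset.sum_le_sum fun k hk => by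
        have hk := Finset.mem_range.1 hk
        refine h _ _ ?_ (ht.2.2.2 k hk) ?_
        · rw [← ht.2.1]; exact ht.le_of_le (Nat.zero_le _) hk.le
        · rw [← ht.2.2.1]; exact ht.le_of_le hk le_rfl
    _ = d - c := by rw [Finset.sum_range_sub, ht.2.1, ht.2.2.1]

lemma le_pbar_of_forall_le {p : ℝ → ℝ} (hp : Measurable p) {u v m : ℝ} (huv : u < v) (hm : 0 < m)
    (h : ∀ t ∈ Ioc u v, m ≤ p t) : m ≤ pbar p u v := by
  have hb : ∀ t ∈ uIoc u v, ‖(p t)⁻¹‖ ≤ m⁻¹ := fun t ht => by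
    rw [uIoc_of_le huv.le] at ht
    have hpt := h t ht
    rw [Real.norm_of_nonneg (inv_nonneg.2 (hm.le.trans hpt))]
    exact inv_anti₀ hm hpt
  have hint : IntervalIntegrable (fun t => (p t)⁻¹) volume u v := by
    refine (intervalIntegrable_const (c := m⁻¹)).mono_fun hp.inv.aestronglyMeasurable ?_
    filter_upwards [ae_restrict_mem measurableSet_uIoc] with t ht
    exact (hb t ht).trans (le_abs_self _)
  have hpos : 0 < ∫ t in u..v, (p t)⁻¹ :=
    intervalIntegral.intervalIntegral_pos_of_pos_on hint
      (fun t ht => inv_pos.2 (hm.trans_le (h t (Ioo_subset_Ioc_self ht)))) huv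
  have hle : ∫ t in u..v, (p t)⁻¹ ≤ m⁻¹ * (v - u) := by
    have := intervalIntegral.norm_integral_le_of_norm_le_const hb
    rw [abs_of_pos (sub_pos.2 huv)] at this
    exact (le_abs_self _).trans this
  have hd := sub_pos.2 huv
  refine le_inv_of_le_inv₀ (mul_pos (inv_pos.2 hd) hpos) ?_
  rw [inv_mul_le_iff₀ hd]
  linarith

lemma abs_sin_log_sub_le {u v : ℝ} (hu : 0 < u) (huv : u < v) :
    |Real.sin (Real.log v) - Real.sin (Real.log u)| * u ≤ v - u := by
  have h1 : |Real.sin (Real.log v) - Real.sin (Real.log u)| ≤ |Real.log v - Real.log u| := by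
    simpa [Real.dist_eq] using Real.lipschitzWith_sin.dist_le_mul (Real.log v) (Real.log u)
  have h2 : Real.log v - Real.log u ≤ v / u - 1 := by
    rw [← Real.log_div (hu.trans huv).ne' hu.ne']
    exact Real.log_le_sub_one_of_pos (div_pos (hu.trans huv) hu)
  rw [abs_of_pos (sub_pos.2 (Real.log_lt_log hu huv))] at h1
  calc _ ≤ (v / u - 1) * u := mul_le_mul_of_nonneg_right (h1.trans h2) hu.le
    _ = v - u := by field_simp

lemma rpow_one_sub_log_le {d u v : ℝ} (hd : 0 ≤ d) (hd' : d ≤ Real.exp (-1)) (hv : 0 < v)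
    (hv1 : v ≤ 1) (h : d * v ≤ v - u) : d ^ (1 - Real.log v) ≤ v - u := by
  have hlog := Real.log_nonpos hv.le hv1
  have h2 : d ^ (-Real.log v) ≤ v := by
    calc _ ≤ Real.exp (-1) ^ (-Real.log v) := Real.rpow_le_rpow hd hd' (by linarith)
      _ = v := by rw [← Real.exp_mul]; simp [Real.exp_log hv]
  rw [sub_eq_add_neg, Real.rpow_one_add' hd (by linarith)]
  exact (mul_le_mul_of_nonneg_left h2 hd).trans h

lemma abs_sin_log_sub_rpow_le {u v : ℝ} (hu : 0 ≤ u) (huv : u < v) (hv1 : v ≤ 1) :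
    |Real.sin (Real.log v) / 6 - Real.sin (Real.log u) / 6| ^
      pbar (fun x => 1 - Real.log x) u v ≤ v - u := by
  have hv : 0 < v := hu.trans_lt huv
  have hlog := Real.log_nonpos hv.le hv1
  set D := |Real.sin (Real.log v) - Real.sin (Real.log u)| with hD
  have hD0 : 0 ≤ D := abs_nonneg _
  have hDu : D * u ≤ v - u := by
    rcases hu.eq_or_lt with rfl | hu
    · simpa using hv.le
    · exact abs_sin_log_sub_le hu huv
  have hD2 : D ≤ 2 := by
    have := abs_sub (Real.sin (Real.log v)) (Real.sin (Real.log u))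
    linarith [Real.abs_sin_le_one (Real.log v), Real.abs_sin_le_one (Real.log u)]
  have hd : |Real.sin (Real.log v) / 6 - Real.sin (Real.log u) / 6| = D / 6 := by
    rw [← sub_div, abs_div, abs_of_pos (by norm_num : (0 : ℝ) < 6)]
  have he : (1 / 3 : ℝ) ≤ Real.exp (-1) := by
    rw [Real.exp_neg, one_div]
    exact inv_anti₀ (Real.exp_pos 1) (by linarith [Real.exp_one_lt_d9])
  rw [hd]
  refine (Real.rpow_le_rpow_of_exponent_ge' (by linarith) (by linarith) (by linarith) <|
    le_pbar_of_forall_le (m := 1 - Real.log v) (by fun_prop) huv (by linarith)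
      fun t ht => ?_).trans
    (rpow_one_sub_log_le (by linarith) (by linarith) hv hv1 ?_)
  · have := Real.log_le_log (hu.trans_lt ht.1) ht.2
    linarith
  · nlinarith [mul_le_mul_of_nonneg_right hD2 (sub_pos.2 huv).le]

lemma memWBV_of_wienerVar_le_one {p f : ℝ → ℝ} {a b : ℝ} (ha : f a = 0)
    (h : wienerVar p f a b ≤ 1) : MemWBV p f a b := by
  refine ⟨ha, lt_of_le_of_lt ?_ (ENNReal.ofReal_lt_top (r := 1))⟩
  exact iInf_le_of_le 1 <| iInf_le_of_le one_pos <| iInf_le_of_le (by simpa using h) le_rfl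

lemma not_ae_one_sub_log_le (M : ℝ) :
    ¬ ∀ᵐ x ∂(volume.restrict (Icc (0 : ℝ) 1)), 1 - Real.log x ≤ M := by
  intro h
  rw [ae_restrict_iff' measurableSet_Icc] at h
  have hsub : Ioo 0 (Real.exp (-|M|)) ⊆ {x | ¬ (x ∈ Icc (0 : ℝ) 1 → 1 - Real.log x ≤ M)} := by
    intro x hx hM
    have h1 : Real.exp (-|M|) ≤ 1 := Real.exp_le_one_iff.2 (by simp)
    have h2 := hM ⟨hx.1.le, hx.2.le.trans h1⟩
    have h3 := (Real.log_lt_iff_lt_exp hx.1).2 hx.2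
    linarith [le_abs_self M]
  have h0 := measure_mono_null hsub (ae_iff.1 h)
  rw [Real.volume_Ioo, ENNReal.ofReal_eq_zero] at h0
  linarith [Real.exp_pos (-|M|)]

lemma not_tendsto_sin_log_div (L : ℝ) :
    ¬ Tendsto (fun x => Real.sin (Real.log x) / 6) (nhdsWithin 0 (Ioc (0 : ℝ) 1)) (nhds L) := by
  intro h
  have hkey : ∀ a : ℝ, 0 ≤ a → Real.sin (-a) / 6 = L := by
    intro a ha
    have ht : Tendsto (fun n : ℕ => Real.exp (-(a + n * (2 * Real.pi)))) atTop
        (nhdsWithin 0 (Ioc (0 : ℝ) 1)) := by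
      refine tendsto_nhdsWithin_iff.2 ⟨?_, Eventually.of_forall fun n => ⟨Real.exp_pos _, ?_⟩⟩
      · refine Real.tendsto_exp_neg_atTop_nhds_zero.comp ?_
        exact tendsto_atTop_add_const_left _ _
          (tendsto_natCast_atTop_atTop.atTop_mul_const (by positivity))
      · exact Real.exp_le_one_iff.2 (neg_nonpos.2 (by positivity))
    refine tendsto_nhds_unique (tendsto_const_nhds (f := (atTop : Filter ℕ))) ?_
    refine (h.comp ht).congr fun n => ?_
    simp only [Function.comp_apply, Real.log_exp, Real.sin_neg, Real.sin_add_nat_mul_two_pi]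
  have h1 := hkey 0 le_rfl
  have h2 := hkey (Real.pi / 2) (by positivity)
  simp only [Real.sin_neg, Real.sin_pi_div_two, Real.sin_zero] at h1 h2
  linarith

/-- there are an integrable, essentially unbounded exponent `p` on `[0,1]`
and `f ∈ WBV_{p(·)}[0,1]` without a right-hand limit at `0`. -/
theorem exists_unbounded_exponent_no_right_limit :
    ∃ p f : ℝ → ℝ,
      (∀ x ∈ Set.Icc (0 : ℝ) 1, 1 ≤ p x) ∧
      MeasureTheory.IntegrableOn p (Set.Icc (0 : ℝ) 1) ∧
      (¬ ∃ M : ℝ, ∀ᵐ x ∂(volume.restrict (Set.Icc (0 : ℝ) 1)), p x ≤ M) ∧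
      MemWBV p f 0 1 ∧
      ¬ ∃ L : ℝ, Filter.Tendsto f (nhdsWithin 0 (Set.Ioc (0 : ℝ) 1)) (nhds L) := by
  refine ⟨fun x => 1 - Real.log x, fun x => Real.sin (Real.log x) / 6, fun x hx => ?_, ?_,
    fun ⟨M, hM⟩ => not_ae_one_sub_log_le M hM, ?_, fun ⟨L, hL⟩ => not_tendsto_sin_log_div L hL⟩
  · linarith [Real.log_nonpos hx.1 hx.2]
  · rw [integrableOn_Icc_iff_integrableOn_Ioc,
      ← intervalIntegrable_iff_integrableOn_Ioc_of_le zero_le_one]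
    exact intervalIntegrable_const.sub intervalIntegral.intervalIntegrable_log'
  · refine memWBV_of_wienerVar_le_one (by simp) ?_
    simpa using wienerVar_le_of_forall_le_sub (c := 0) (d := 1)
      fun u v hu huv hv => abs_sin_log_sub_rpow_le hu huv hv
end

section
/- Let a < b be reals, let p : [a,b] → [1,∞) be Lebesgue integrable and essentially bounded (esssup_{[a,b]} p < ∞), and let f ∈ WBV_{p(·)}[a,b]. Then the set of points of [a,b] at which f is discontinuous is at most countable. -/
open MeasureTheory Set Filter
open scoped ENNReal

/-- An exponent lying in `[1, K]` almost everywhere has harmonic means in `(0, K]`. -/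
theorem pbar_pos_and_le {p : ℝ → ℝ} {a b K : ℝ} (hp1 : ∀ x ∈ Set.Icc a b, 1 ≤ p x)
    (hpint : IntegrableOn p (Set.Icc a b)) (hK : 0 < K)
    (hpK : ∀ᵐ x ∂(volume.restrict (Set.Icc a b)), p x ≤ K)
    {u v : ℝ} (hu : a ≤ u) (huv : u < v) (hv : v ≤ b) :
    0 < pbar p u v ∧ pbar p u v ≤ K := by
  have hmem : ∀ᵐ x ∂(volume.restrict (Set.Icc a b)), x ∈ Set.Icc a b :=
    ae_restrict_mem measurableSet_Icc
  have hint : IntegrableOn (fun x => (p x)⁻¹) (Set.Icc a b) := by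
    refine Integrable.mono' (g := fun _ => (1 : ℝ)) (integrable_const _)
      hpint.aemeasurable.inv.aestronglyMeasurable ?_
    filter_upwards [hmem] with x hx
    have h1 := hp1 x hx
    rw [Real.norm_of_nonneg (by positivity)]
    exact inv_le_one_of_one_le₀ h1
  have hsub : Set.Icc u v ⊆ Set.Icc a b := Set.Icc_subset_Icc hu hv
  have hlow : ∫ _ in u..v, K⁻¹ ≤ ∫ x in u..v, (p x)⁻¹ := by
    refine intervalIntegral.integral_mono_ae_restrict huv.le intervalIntegrable_const
      ((intervalIntegrable_iff_integrableOn_Icc_of_le huv.le).2 (hint.mono_set hsub)) ?_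
    filter_upwards [ae_restrict_of_ae_restrict_of_subset hsub hpK,
      ae_restrict_of_ae_restrict_of_subset hsub hmem] with x hx hxm
    have h1 := hp1 x hxm
    exact inv_anti₀ (by linarith) hx
  rw [intervalIntegral.integral_const, smul_eq_mul] at hlow
  have hd : 0 < v - u := sub_pos.2 huv
  have hmean : K⁻¹ ≤ (v - u)⁻¹ * ∫ x in u..v, (p x)⁻¹ := by
    rw [inv_mul_eq_div, le_div_iff₀ hd]
    linarith
  have hK' : 0 < K⁻¹ := inv_pos.2 hK
  exact ⟨inv_pos.2 (hK'.trans_le hmean), inv_le_of_inv_le₀ hK hmean⟩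

/-- Appending a point `y` to a partition of `[a, x]` gives a partition of `[a, y]`. -/
theorem IsPartition.ofReal_sum_add_le_wienerVar {p g : ℝ → ℝ} {a x y : ℝ} {n : ℕ} {t : ℕ → ℝ}
    (ht : IsPartition a x n t) (hxy : x < y) :
    ENNReal.ofReal (∑ k ∈ Finset.range n, |g (t (k + 1)) - g (t k)| ^ pbar p (t k) (t (k + 1)))
      + ENNReal.ofReal (|g y - g x| ^ pbar p x y) ≤ wienerVar p g a y := by
  obtain ⟨hn, h0, hx, hlt⟩ := ht
  let s : ℕ → ℝ := fun k => if k ≤ n then t k else y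
  have hs : ∀ k ≤ n, s k = t k := fun k hk => if_pos hk
  have hsn : s (n + 1) = y := if_neg (by omega)
  have hpart : IsPartition a y (n + 1) s := by
    refine ⟨by omega, by rw [hs 0 (by omega), h0], hsn, fun k hk => ?_⟩
    rcases Nat.lt_succ_iff_lt_or_eq.1 hk with hk | rfl
    · rw [hs k hk.le, hs (k + 1) hk]
      exact hlt k hk
    · rw [hs k le_rfl, hsn, hx]
      exact hxy
  have hsum : ∑ k ∈ Finset.range (n + 1), |g (s (k + 1)) - g (s k)| ^ pbar p (s k) (s (k + 1))
      = (∑ k ∈ Finset.range n, |g (t (k + 1)) - g (t k)| ^ pbar p (t k) (t (k + 1)))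
        + |g y - g x| ^ pbar p x y := by
    rw [Finset.sum_range_succ, hsn, hs n le_rfl, hx]
    congr 1
    refine Finset.sum_congr rfl fun k hk => ?_
    have hk := Finset.mem_range.1 hk
    rw [hs k hk.le, hs (k + 1) hk]
  rw [← ENNReal.ofReal_add (by positivity) (by positivity), ← hsum]
  exact le_iSup_of_le (n + 1) (le_iSup_of_le s (le_iSup_of_le hpart le_rfl))

theorem isPartition_one {x y : ℝ} (hxy : x < y) :
    IsPartition x y 1 (fun k => if k = 0 then x else y) := by
  refine ⟨one_pos, by simp, by simp, fun k hk => ?_⟩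
  obtain rfl : k = 0 := by omega
  simpa using hxy

/-- The variation over `[a, y]` dominates the variation over `[a, x]` plus one further step. -/
theorem wienerVar_add_le {p g : ℝ → ℝ} {a x y : ℝ} (hax : a ≤ x) (hxy : x < y) :
    wienerVar p g a x + ENNReal.ofReal (|g y - g x| ^ pbar p x y) ≤ wienerVar p g a y := by
  have hstep : ENNReal.ofReal (|g y - g x| ^ pbar p x y) ≤ wienerVar p g a y := by
    rcases hax.eq_or_lt with rfl | hax
    · exact le_iSup_of_le 1 (le_iSup_of_le _ (le_iSup_of_le (isPartition_one hxy) (by simp)))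
    · exact le_add_self.trans ((isPartition_one hax).ofReal_sum_add_le_wienerVar hxy)
  have hle : wienerVar p g a x
      ≤ wienerVar p g a y - ENNReal.ofReal (|g y - g x| ^ pbar p x y) :=
    iSup_le fun n => iSup_le fun t => iSup_le fun ht =>
      ENNReal.le_sub_of_add_le_right ENNReal.ofReal_ne_top (ht.ofReal_sum_add_le_wienerVar hxy)
  calc _ ≤ _ := add_le_add_left hle _
    _ = _ := tsub_add_cancel_of_le hstep

/-- A function whose increments raised to a fixed power are dominated by those of a monotone
function has at most countably many discontinuities. -/
theorem countable_not_continuousWithinAt_of_rpow_le {g G : ℝ → ℝ} {s : Set ℝ} {K : ℝ}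
    (hK : 0 < K) (hG : ∀ x ∈ s, ∀ y ∈ s, x < y → |g y - g x| ^ K ≤ G y - G x) :
    {x ∈ s | ¬ ContinuousWithinAt g s x}.Countable := by
  have hmono : MonotoneOn G s := by
    intro x hx y hy hxy
    rcases hxy.eq_or_lt with rfl | hxy
    · exact le_rfl
    · exact sub_nonneg.1 ((by positivity : 0 ≤ |g y - g x| ^ K).trans (hG x hx y hy hxy))
  refine hmono.countable_not_continuousWithinAt.mono ?_
  rintro x ⟨hx, hnc⟩
  refine ⟨hx, fun hc => hnc ?_⟩
  have habs : ∀ y ∈ s, |g y - g x| ^ K ≤ |G y - G x| := by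
    intro y hy
    rcases lt_trichotomy x y with h | rfl | h
    · exact (hG x hx y hy h).trans (le_abs_self _)
    · simp [Real.zero_rpow hK.ne']
    · rw [abs_sub_comm (g y), abs_sub_comm (G y)]
      exact (hG y hy x hx h).trans (le_abs_self _)
  have hlim : Tendsto (fun y => |G y - G x| ^ K⁻¹) (nhdsWithin x s) (nhds 0) := by
    have h : Tendsto (fun y => |G y - G x|) (nhdsWithin x s) (nhds 0) := by
      simpa using (hc.tendsto.sub_const (G x)).abs
    simpa [Real.zero_rpow (inv_pos.2 hK).ne'] using
      h.rpow_const (p := K⁻¹) (Or.inr (inv_pos.2 hK).le)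
  refine tendsto_iff_dist_tendsto_zero.2 (squeeze_zero' (Eventually.of_forall fun _ => dist_nonneg)
    ?_ hlim)
  filter_upwards [self_mem_nhdsWithin] with y hy
  rw [Real.dist_eq, ← Real.rpow_rpow_inv (abs_nonneg (g y - g x)) hK.ne']
  exact Real.rpow_le_rpow (by positivity) (habs y hy) (inv_pos.2 hK).le

/-- for essentially bounded exponents, the set of discontinuity points of
`f ∈ WBV_{p(·)}[a,b]` is at most countable. -/
theorem wbv_discontinuities_countable (a b : ℝ) (hab : a < b) (p : ℝ → ℝ)
    (hp1 : ∀ x ∈ Set.Icc a b, 1 ≤ p x)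
    (hpint : MeasureTheory.IntegrableOn p (Set.Icc a b))
    (hesssup : ∃ M : ℝ, ∀ᵐ x ∂(volume.restrict (Set.Icc a b)), p x ≤ M)
    (f : ℝ → ℝ) (hf : MemWBV p f a b) :
    {x ∈ Set.Icc a b | ¬ ContinuousWithinAt f (Set.Icc a b) x}.Countable := by
  obtain ⟨M, hM⟩ := hesssup
  have hK : 0 < max M 1 := one_pos.trans_le (le_max_right _ _)
  have hpK : ∀ᵐ x ∂(volume.restrict (Set.Icc a b)), p x ≤ max M 1 :=
    hM.mono fun x hx => hx.trans (le_max_left _ _)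
  obtain ⟨l, hl, hvar⟩ : ∃ l : ℝ, 0 < l ∧ wienerVar p (fun x => f x / l) a b ≤ 1 := by
    have h := hf.2
    simp only [luxNorm, iInf_lt_iff] at h
    obtain ⟨l, hl, hv, -⟩ := h
    exact ⟨l, hl, hv⟩
  set g : ℝ → ℝ := fun x => f x / l with hg
  have hone : ∀ x ∈ Set.Icc a b, wienerVar p g a x ≤ 1 := by
    intro x hx
    rcases hx.2.eq_or_lt with rfl | hxb
    · exact hvar
    · exact le_self_add.trans ((wienerVar_add_le hx.1 hxb).trans hvar)
  have hcount : {x ∈ Set.Icc a b | ¬ ContinuousWithinAt g (Set.Icc a b) x}.Countable := by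
    refine countable_not_continuousWithinAt_of_rpow_le (G := fun x => (wienerVar p g a x).toReal)
      hK fun x hx y hy hxy => ?_
    have hfin : ∀ z ∈ Set.Icc a b, wienerVar p g a z ≠ ⊤ := fun z hz =>
      ne_top_of_le_ne_top ENNReal.one_ne_top (hone z hz)
    have hadd := wienerVar_add_le (p := p) (g := g) hx.1 hxy
    have hpow : 0 ≤ |g y - g x| ^ pbar p x y := by positivity
    obtain ⟨hpos, hle⟩ := pbar_pos_and_le hp1 hpint hK hpK hx.1 hxy hy.2
    have hstep : |g y - g x| ≤ 1 := by
      have h : |g y - g x| ^ pbar p x y ≤ 1 :=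
        ENNReal.ofReal_le_one.1 (le_add_self.trans (hadd.trans (hone y hy)))
      by_contra! hlt
      exact absurd h (Real.one_lt_rpow hlt hpos).not_ge
    have hreal := ENNReal.toReal_mono (hfin y hy) hadd
    rw [ENNReal.toReal_add (hfin x hx) ENNReal.ofReal_ne_top, ENNReal.toReal_ofReal hpow] at hreal
    have hexp : |g y - g x| ^ max M 1 ≤ |g y - g x| ^ pbar p x y :=
      Real.rpow_le_rpow_of_exponent_ge_of_imp (abs_nonneg _) hstep hle fun _ h =>
        absurd h hK.ne'
    linarith
  refine hcount.mono ?_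
  rintro x ⟨hx, hnc⟩
  refine ⟨hx, fun hc => hnc ?_⟩
  have hfg : f = fun z => g z * l := by
    funext z
    simp [hg, hl.ne']
  rw [hfg]
  exact hc.mul continuousWithinAt_const
end

section
/- Let a < b be reals, let p : [a,b] → [1,∞) be measurable and bounded, and let f ∈ BV^{p(·)}[a,b]. Then the set of points of [a,b] at which f is discontinuous is at most countable. -/
open MeasureTheory Set Filter
open scoped ENNReal

/-- Appending a point to a tagged partition of `[a,x]`. -/
theorem ofReal_sum_add_ofReal_le_taggedVar {p f : ℝ → ℝ} {a x y : ℝ} (hxy : x < y)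
    {n : ℕ} {t ξ : ℕ → ℝ} (ht : IsPartition a x n t)
    (hξ : ∀ k < n, ξ k ∈ Set.Icc (t k) (t (k + 1))) :
    ENNReal.ofReal (∑ k ∈ Finset.range n, |f (t (k + 1)) - f (t k)| ^ p (ξ k)) +
      ENNReal.ofReal (|f y - f x| ^ p y) ≤ taggedVar p f a y := by
  obtain ⟨hn, h0, hnx, hlt⟩ := ht
  let t' : ℕ → ℝ := fun k => if k ≤ n then t k else y
  let ξ' : ℕ → ℝ := fun k => if k < n then ξ k else y
  have hpart : IsPartition a y (n + 1) t' ∧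
      ∀ k < n + 1, ξ' k ∈ Set.Icc (t' k) (t' (k + 1)) := by
    refine ⟨⟨n.succ_pos, by simp [t', h0], by simp [t'], fun k hk => ?_⟩, fun k hk => ?_⟩
    · rcases Nat.lt_succ_iff_lt_or_eq.1 hk with h | rfl
      · simpa [t', h.le, Nat.succ_le_of_lt h] using hlt k h
      · simpa [t', hnx] using hxy
    · rcases Nat.lt_succ_iff_lt_or_eq.1 hk with h | rfl
      · simpa [t', ξ', h, h.le, Nat.succ_le_of_lt h] using hξ k h
      · simpa [t', ξ', hnx] using hxy.le
  have hsum : ∑ k ∈ Finset.range (n + 1), |f (t' (k + 1)) - f (t' k)| ^ p (ξ' k) =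
      ∑ k ∈ Finset.range n, |f (t (k + 1)) - f (t k)| ^ p (ξ k) + |f y - f x| ^ p y := by
    rw [Finset.sum_range_succ]
    congr 1
    · refine Finset.sum_congr rfl fun k hk => ?_
      have h := Finset.mem_range.1 hk
      simp [t', ξ', h, h.le, Nat.succ_le_of_lt h]
    · simp [t', ξ', hnx]
  rw [← ENNReal.ofReal_add (Finset.sum_nonneg fun k _ => by positivity) (by positivity), ← hsum]
  exact le_iSup_of_le (n + 1) <| le_iSup_of_le t' <| le_iSup_of_le ξ' <|
    le_iSup_of_le hpart le_rfl

theorem ofReal_le_taggedVar {p f : ℝ → ℝ} {a b ξ : ℝ} (hab : a < b) (hξ : ξ ∈ Set.Icc a b) :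
    ENNReal.ofReal (|f b - f a| ^ p ξ) ≤ taggedVar p f a b := by
  have hpart : IsPartition a b 1 (fun k => if k = 0 then a else b) ∧
      ∀ k < 1, (fun _ : ℕ => ξ) k ∈
        Set.Icc (if k = 0 then a else b) (if k + 1 = 0 then a else b) := by
    refine ⟨⟨one_pos, by simp, by simp, fun k hk => ?_⟩, fun k hk => ?_⟩
    · obtain rfl : k = 0 := by omega
      simpa using hab
    · obtain rfl : k = 0 := by omega
      simpa using hξ
  refine le_iSup_of_le 1 <| le_iSup_of_le _ <| le_iSup_of_le _ <| le_iSup_of_le hpart ?_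
  simp

/-- The tagged variation is superadditive when one increment is appended. -/
theorem taggedVar_add_ofReal_le {p f : ℝ → ℝ} {a x y : ℝ} (hax : a ≤ x) (hxy : x < y) :
    taggedVar p f a x + ENNReal.ofReal (|f y - f x| ^ p y) ≤ taggedVar p f a y := by
  refine add_le_of_le_tsub_right_of_le ?_ ?_
  · rcases hax.eq_or_lt with rfl | hax
    · exact ofReal_le_taggedVar hxy (Set.right_mem_Icc.2 hxy.le)
    · have hpart : IsPartition a x 1 (fun k => if k = 0 then a else x) := by
        refine ⟨one_pos, by simp, by simp, fun k hk => ?_⟩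
        obtain rfl : k = 0 := by omega
        simpa using hax
      refine le_add_self.trans
        (ofReal_sum_add_ofReal_le_taggedVar hxy hpart (ξ := fun _ => a) fun k hk => ?_)
      obtain rfl : k = 0 := by omega
      simpa using hax.le
  · refine iSup_le fun n => iSup_le fun t => iSup_le fun ξ => iSup_le fun h => ?_
    exact ENNReal.le_sub_of_add_le_right ENNReal.ofReal_ne_top
      (ofReal_sum_add_ofReal_le_taggedVar hxy h.1 h.2)

theorem monotoneOn_taggedVar (p f : ℝ → ℝ) (a : ℝ) :
    MonotoneOn (taggedVar p f a) (Set.Ici a) := by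
  intro x hx y _ hxy
  rcases hxy.eq_or_lt with rfl | hxy
  · exact le_rfl
  · exact le_self_add.trans (taggedVar_add_ofReal_le hx hxy)

/-- for bounded measurable exponents, the set of discontinuity points of
`f ∈ BV^{p(·)}[a,b]` is at most countable. -/
theorem bv_discontinuities_countable (a b : ℝ) (hab : a < b) (p : ℝ → ℝ)
    (hpm : Measurable p)
    (hp1 : ∀ x ∈ Set.Icc a b, 1 ≤ p x)
    (hpbd : ∃ M : ℝ, ∀ x ∈ Set.Icc a b, p x ≤ M)
    (f : ℝ → ℝ) (hf : MemBV p f a b) :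
    {x ∈ Set.Icc a b | ¬ ContinuousWithinAt f (Set.Icc a b) x}.Countable := by
  obtain ⟨M, hM⟩ := hpbd
  set v : ℝ → ℝ := fun x => (taggedVar p f a x).toReal with hv
  have hfin : ∀ x ∈ Set.Icc a b, taggedVar p f a x ≠ ⊤ := fun x hx =>
    ((monotoneOn_taggedVar p f a hx.1 hab.le hx.2).trans_lt hf.2).ne
  have hmono : MonotoneOn v (Set.Icc a b) := fun x hx y hy hxy =>
    ENNReal.toReal_mono (hfin y hy) (monotoneOn_taggedVar p f a hx.1 hy.1 hxy)
  have hincr : ∀ x ∈ Set.Icc a b, ∀ y ∈ Set.Icc a b, x < y →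
      |f y - f x| ^ p y ≤ v y - v x := by
    intro x hx y hy hxy
    have h := ENNReal.toReal_mono (hfin y hy) (taggedVar_add_ofReal_le (p := p) (f := f) hx.1 hxy)
    rw [ENNReal.toReal_add (hfin x hx) ENNReal.ofReal_ne_top,
      ENNReal.toReal_ofReal (by positivity)] at h
    simp only [hv]
    linarith
  have hsmall : ∀ ε : ℝ, 0 < ε → ε ≤ 1 → ∀ x ∈ Set.Icc a b, ∀ y ∈ Set.Icc a b, x < y →
      |v y - v x| < ε ^ M → |f y - f x| < ε := by
    intro ε hε hε1 x hx y hy hxy hlt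
    by_contra! hge
    have h1 : ε ^ M ≤ ε ^ p y := Real.rpow_le_rpow_of_exponent_ge hε hε1 (hM y hy)
    have h2 : ε ^ p y ≤ |f y - f x| ^ p y :=
      Real.rpow_le_rpow hε.le hge (zero_le_one.trans (hp1 y hy))
    linarith [hincr x hx y hy hxy, le_abs_self (v y - v x)]
  refine hmono.countable_not_continuousWithinAt.mono ?_
  rintro x ⟨hx, hfx⟩
  refine ⟨hx, fun hc => hfx ?_⟩
  rw [Metric.continuousWithinAt_iff] at hc ⊢
  intro ε hε
  have hε' : 0 < min ε 1 := lt_min hε one_pos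
  obtain ⟨δ, hδ, h⟩ := hc (min ε 1 ^ M) (Real.rpow_pos_of_pos hε' M)
  refine ⟨δ, hδ, fun y hy hyx => ?_⟩
  have hvy := h hy hyx
  rw [Real.dist_eq] at hvy ⊢
  refine lt_of_lt_of_le ?_ (min_le_left ε 1)
  rcases lt_trichotomy x y with hxy | rfl | hxy
  · exact hsmall _ hε' (min_le_right _ _) x hx y hy hxy hvy
  · simpa using hε
  · rw [abs_sub_comm] at hvy ⊢
    exact hsmall _ hε' (min_le_right _ _) y hy x hx hxy hvy
end

section
/- There exist a Lebesgue integrable, essentially unbounded exponent p : [0,1] → [1,∞) (i.e. esssup_{[0,1]} p = ∞) and a function f ∈ WBV_{p(·)}[0,1] such that the set of points of [0,1] at which f is discontinuous is uncountable. -/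
open MeasureTheory Set Filter
open scoped ENNReal

/-- The distance to the Cantor set. -/
noncomputable def cantorDist (x : ℝ) : ℝ := Metric.infDist x cantorSet

/-- The exponent `max 1 (-log (dist x C))`, where `C` is the Cantor set. -/
noncomputable def cantorExponent (x : ℝ) : ℝ := max 1 (-Real.log (cantorDist x))

lemma exists_finset_cover_cantorSet (n : ℕ) :
    ∃ s : Finset ℝ, s.card ≤ 2 ^ n ∧ ∀ x ∈ cantorSet, ∃ y ∈ s, |x - y| ≤ (1 / 3) ^ n := by
  classical
  induction n with
  | zero =>
    refine ⟨{0}, by simp, fun x hx => ⟨0, by simp, ?_⟩⟩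
    have := cantorSet_subset_unitInterval hx
    rw [sub_zero, pow_zero, abs_of_nonneg this.1]
    exact this.2
  | succ n ih =>
    obtain ⟨s, hs, hcov⟩ := ih
    refine ⟨s.image (fun y => y / 3) ∪ s.image (fun y => (2 + y) / 3), ?_, fun x hx => ?_⟩
    · calc _ ≤ (s.image (fun y => y / 3)).card + (s.image (fun y => (2 + y) / 3)).card :=
            Finset.card_union_le _ _
        _ ≤ s.card + s.card := add_le_add Finset.card_image_le Finset.card_image_le
        _ ≤ 2 ^ (n + 1) := by rw [pow_succ]; omega
    · rw [cantorSet_eq_union_halves] at hx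
      rcases hx with ⟨z, hz, rfl⟩ | ⟨z, hz, rfl⟩
      · obtain ⟨y, hy, hzy⟩ := hcov z hz
        refine ⟨y / 3, Finset.mem_union_left _ (Finset.mem_image_of_mem _ hy), ?_⟩
        rw [abs_le] at hzy ⊢
        rw [pow_succ]
        constructor <;> dsimp only <;> linarith [hzy.1, hzy.2]
      · obtain ⟨y, hy, hzy⟩ := hcov z hz
        refine ⟨(2 + y) / 3, Finset.mem_union_right _ (Finset.mem_image_of_mem _ hy), ?_⟩
        rw [abs_le] at hzy ⊢
        rw [pow_succ]
        constructor <;> dsimp only <;> linarith [hzy.1, hzy.2]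

lemma volume_cantorDist_lt_le (n : ℕ) :
    volume {x | cantorDist x < Real.exp (-n)} ≤ ENNReal.ofReal (4 * (2 * Real.exp (-1)) ^ n) := by
  obtain ⟨s, hs, hcov⟩ := exists_finset_cover_cantorSet n
  set r := Real.exp (-n) with hr
  have hrpow : r = Real.exp (-1) ^ n := by rw [hr, ← Real.exp_nat_mul]; ring_nf
  have hle : ((1 : ℝ) / 3) ^ n ≤ r := by
    rw [hrpow, Real.exp_neg, one_div]
    gcongr
    exact Real.exp_one_lt_three.le
  have hsub : {x | cantorDist x < r} ⊆ ⋃ y ∈ s, Icc (y - 2 * r) (y + 2 * r) := by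
    intro x hx
    obtain ⟨c, hc, hxc⟩ := (Metric.infDist_lt_iff ⟨0, zero_mem_cantorSet⟩).1 hx
    obtain ⟨y, hy, hcy⟩ := hcov c hc
    rw [Real.dist_eq, abs_lt] at hxc
    rw [abs_le] at hcy
    simp only [mem_iUnion]
    exact ⟨y, hy, by linarith [hxc.1, hcy.1], by linarith [hxc.2, hcy.2]⟩
  calc volume {x | cantorDist x < r} ≤ volume (⋃ y ∈ s, Icc (y - 2 * r) (y + 2 * r)) :=
        measure_mono hsub
    _ ≤ ∑ y ∈ s, volume (Icc (y - 2 * r) (y + 2 * r)) := measure_biUnion_finset_le _ _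
    _ = ∑ y ∈ s, ENNReal.ofReal (4 * r) := by
        refine Finset.sum_congr rfl fun y _ => ?_
        rw [Real.volume_Icc]
        ring_nf
    _ = ENNReal.ofReal (s.card * (4 * r)) := by
        rw [Finset.sum_const, nsmul_eq_mul, ENNReal.ofReal_mul (Nat.cast_nonneg _),
          ENNReal.ofReal_natCast]
    _ ≤ ENNReal.ofReal (4 * (2 * Real.exp (-1)) ^ n) := by
        apply ENNReal.ofReal_le_ofReal
        have : (s.card : ℝ) ≤ 2 ^ n := by exact_mod_cast hs
        rw [mul_pow, ← hrpow]
        have hrpos : 0 < r := Real.exp_pos _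
        nlinarith

lemma two_mul_exp_neg_one_lt_one : 2 * Real.exp (-1) < 1 := by
  rw [Real.exp_neg, ← div_eq_mul_inv, div_lt_one (Real.exp_pos 1)]
  linarith [Real.add_one_lt_exp (one_ne_zero)]

lemma tsum_volume_cantorDist_lt_ne_top :
    ∑' n : ℕ, volume {x | cantorDist x < Real.exp (-n)} ≠ ⊤ := by
  refine ne_top_of_le_ne_top ?_ (ENNReal.tsum_le_tsum volume_cantorDist_lt_le)
  have hsum : Summable fun n : ℕ => 4 * (2 * Real.exp (-1)) ^ n :=
    (summable_geometric_of_lt_one (by positivity) two_mul_exp_neg_one_lt_one).mul_left 4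
  rw [← ENNReal.ofReal_tsum_of_nonneg (fun n => by positivity) hsum]
  exact ENNReal.ofReal_ne_top

lemma cantorDist_eq_zero_iff {x : ℝ} : cantorDist x = 0 ↔ x ∈ cantorSet :=
  (isClosed_cantorSet.mem_iff_infDist_zero ⟨0, zero_mem_cantorSet⟩).symm

lemma cantorDist_pos {x : ℝ} (hx : x ∉ cantorSet) : 0 < cantorDist x :=
  lt_of_le_of_ne Metric.infDist_nonneg fun h => hx (cantorDist_eq_zero_iff.1 h.symm)

lemma cantorDist_le {x c : ℝ} (hc : c ∈ cantorSet) : cantorDist x ≤ |x - c| :=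
  Metric.infDist_le_dist_of_mem hc

lemma volume_cantorSet : volume cantorSet = 0 := by
  have hlim := ENNReal.tendsto_atTop_zero_of_tsum_ne_top tsum_volume_cantorDist_lt_ne_top
  refine le_antisymm (ge_of_tendsto' hlim fun n => measure_mono fun x hx => ?_) zero_le
  rw [mem_ofPred_eq, cantorDist_eq_zero_iff.2 hx]
  exact Real.exp_pos _

lemma not_countable_cantorSet : ¬ cantorSet.Countable := by
  intro h
  have h1 : Countable cantorSet := h.to_subtype
  have h2 : Countable (ℕ → Bool) := cantorSetEquivNatToBool.symm.injective.countable
  have h3 : Countable (Set ℕ) := by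
    classical
    refine Function.Injective.countable (f := fun (s : Set ℕ) n => decide (n ∈ s)) fun s t h => ?_
    ext n
    simpa using congrFun h n
  obtain ⟨g, hg⟩ := exists_injective_nat (Set ℕ)
  exact Function.cantor_injective g hg

lemma measurable_cantorDist : Measurable cantorDist :=
  (Metric.continuous_infDist_pt _).measurable

lemma measurable_cantorExponent : Measurable cantorExponent :=
  measurable_const.max (Real.measurable_log.comp measurable_cantorDist).neg

lemma one_le_cantorExponent (x : ℝ) : 1 ≤ cantorExponent x := le_max_left _ _

lemma ofReal_le_tsum_indicator (y : ℝ) :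
    ENNReal.ofReal y ≤ ∑' n : ℕ, if (n : ℝ) < y then (1 : ℝ≥0∞) else 0 := by
  calc ENNReal.ofReal y ≤ (⌈y⌉₊ : ℝ≥0∞) := by
        rw [← ENNReal.ofReal_natCast]
        exact ENNReal.ofReal_le_ofReal (Nat.le_ceil y)
    _ = ∑ n ∈ Finset.range ⌈y⌉₊, if (n : ℝ) < y then (1 : ℝ≥0∞) else 0 := by
        rw [Finset.sum_congr rfl fun n hn =>
          if_pos (Nat.lt_ceil.1 (Finset.mem_range.1 hn))]
        simp
    _ ≤ _ := ENNReal.sum_le_tsum _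

lemma lintegral_neg_log_cantorDist_ne_top :
    ∫⁻ x, ENNReal.ofReal (-Real.log (cantorDist x)) ≠ ⊤ := by
  refine ne_top_of_le_ne_top tsum_volume_cantorDist_lt_ne_top ?_
  have hmeas (n : ℕ) : MeasurableSet {x | cantorDist x < Real.exp (-n)} :=
    measurableSet_lt measurable_cantorDist measurable_const
  calc ∫⁻ x, ENNReal.ofReal (-Real.log (cantorDist x))
      ≤ ∫⁻ x, ∑' n : ℕ, {x | cantorDist x < Real.exp (-n)}.indicator 1 x := by
        refine lintegral_mono fun x => (ofReal_le_tsum_indicator _).trans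
          (ENNReal.tsum_le_tsum fun n => ?_)
        split_ifs with h
        · have hx : x ∉ cantorSet := by
            intro hx
            rw [cantorDist_eq_zero_iff.2 hx, Real.log_zero, neg_zero] at h
            exact absurd h (not_lt.2 n.cast_nonneg)
          have : cantorDist x < Real.exp (-n) :=
            (Real.log_lt_iff_lt_exp (cantorDist_pos hx)).1 (by linarith)
          rw [indicator_of_mem (show x ∈ {x | cantorDist x < Real.exp (-n)} from this)]
          exact le_rfl
        · exact zero_le
    _ = ∑' n : ℕ, volume {x | cantorDist x < Real.exp (-n)} := by
        rw [lintegral_tsum fun n => (measurable_one.indicator (hmeas n)).aemeasurable]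
        exact tsum_congr fun n => lintegral_indicator_one (hmeas n)

lemma integrableOn_cantorExponent : IntegrableOn cantorExponent (Icc 0 1) := by
  refine ⟨measurable_cantorExponent.aestronglyMeasurable, ?_⟩
  have hle (x : ℝ) : ‖cantorExponent x‖ₑ ≤ 1 + ENNReal.ofReal (-Real.log (cantorDist x)) := by
    rw [Real.enorm_of_nonneg (zero_le_one.trans (one_le_cantorExponent x)), cantorExponent,
      ENNReal.ofReal_max, ENNReal.ofReal_one]
    exact max_le le_self_add le_add_self
  refine (lintegral_mono hle).trans_lt ?_
  rw [lintegral_add_left measurable_const]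
  refine ENNReal.add_lt_top.2 ⟨by simp, ?_⟩
  exact (setLIntegral_le_lintegral _ _).trans_lt lintegral_neg_log_cantorDist_ne_top.lt_top

lemma not_ae_bdd_cantorExponent :
    ¬ ∃ M : ℝ, ∀ᵐ x ∂(volume.restrict (Icc (0 : ℝ) 1)), cantorExponent x ≤ M := by
  rintro ⟨M, hM⟩
  rw [ae_restrict_iff' measurableSet_Icc] at hM
  have hC : ∀ᵐ x, x ∉ cantorSet := measure_eq_zero_iff_ae_notMem.1 volume_cantorSet
  have hnull : volume (Ioo 0 (min 1 (Real.exp (-M)))) = 0 := by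
    rw [measure_eq_zero_iff_ae_notMem]
    filter_upwards [hM, hC] with x hx hxC hmem
    have h1 := hx ⟨hmem.1.le, (hmem.2.trans_le (min_le_left _ _)).le⟩
    have h2 : cantorDist x < Real.exp (-M) := by
      refine (cantorDist_le zero_mem_cantorSet).trans_lt ?_
      rw [sub_zero, abs_of_pos hmem.1]
      exact hmem.2.trans_le (min_le_right _ _)
    have h3 := (Real.log_lt_iff_lt_exp (cantorDist_pos hxC)).2 h2
    linarith [le_max_right 1 (-Real.log (cantorDist x)), h1.trans' (le_max_right _ _)]
  rw [Real.volume_Ioo, ENNReal.ofReal_eq_zero, sub_zero] at hnull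
  exact absurd hnull (not_le.2 (lt_min one_pos (Real.exp_pos _)))

lemma intervalIntegrable_inv_cantorExponent (u v : ℝ) :
    IntervalIntegrable (fun t => (cantorExponent t)⁻¹) volume u v := by
  refine (intervalIntegrable_const (c := (1 : ℝ))).mono_fun
    measurable_cantorExponent.inv.aestronglyMeasurable (Eventually.of_forall fun t => ?_)
  have h := one_le_cantorExponent t
  dsimp only
  rw [Real.norm_of_nonneg (by positivity), norm_one]
  exact inv_le_one_of_one_le₀ h

lemma pbar_cantorExponent_pos {u v : ℝ} (h : u < v) : 0 < pbar cantorExponent u v := by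
  refine inv_pos.2 (mul_pos (inv_pos.2 (sub_pos.2 h)) ?_)
  exact intervalIntegral.intervalIntegral_pos_of_pos (intervalIntegrable_inv_cantorExponent u v)
    (fun t => inv_pos.2 (one_pos.trans_le (one_le_cantorExponent t))) h

lemma neg_log_le_pbar_cantorExponent {u v c : ℝ} (h : u < v) (hc : c ∈ cantorSet)
    (hcuv : c ∈ Icc u v) : -Real.log (v - u) ≤ pbar cantorExponent u v := by
  rcases le_or_gt (-Real.log (v - u)) 0 with hL | hL
  · exact hL.trans (pbar_cantorExponent_pos h).le
  have hC : ∀ᵐ x, x ∉ cantorSet := measure_eq_zero_iff_ae_notMem.1 volume_cantorSet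
  have hle : ∫ t in u..v, (cantorExponent t)⁻¹ ≤ ∫ _ in u..v, (-Real.log (v - u))⁻¹ := by
    refine intervalIntegral.integral_mono_ae_restrict h.le
      (intervalIntegrable_inv_cantorExponent u v) intervalIntegrable_const ?_
    filter_upwards [ae_restrict_of_ae hC, ae_restrict_mem measurableSet_Icc] with t htC ht
    refine inv_anti₀ hL (le_max_of_le_right (neg_le_neg
      (Real.log_le_log (cantorDist_pos htC) ((cantorDist_le hc).trans ?_))))
    rw [abs_le]
    constructor <;> linarith [ht.1, ht.2, hcuv.1, hcuv.2]
  rw [intervalIntegral.integral_const, smul_eq_mul] at hle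
  have huv : 0 < v - u := sub_pos.2 h
  have hpos := pbar_cantorExponent_pos h
  rw [pbar, inv_pos] at hpos
  refine le_inv_of_le_inv₀ hpos ?_
  rwa [inv_mul_le_iff₀ huv]

/-- The indicator of the complement of the Cantor set. -/
noncomputable def cantorCompl (x : ℝ) : ℝ := cantorSetᶜ.indicator 1 x

lemma cantorCompl_of_mem {x : ℝ} (hx : x ∈ cantorSet) : cantorCompl x = 0 :=
  indicator_of_notMem (not_not.2 hx) _

lemma cantorCompl_of_notMem {x : ℝ} (hx : x ∉ cantorSet) : cantorCompl x = 1 :=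
  indicator_of_mem (show x ∈ cantorSetᶜ from hx) _

lemma exp_neg_one_rpow_pbar_le {u v c : ℝ} (h : u < v) (hc : c ∈ cantorSet)
    (hcuv : c ∈ Icc u v) : (1 / Real.exp 1) ^ pbar cantorExponent u v ≤ v - u := by
  rw [one_div, ← Real.exp_neg, ← Real.exp_mul, ← Real.le_log_iff_exp_le (sub_pos.2 h)]
  linarith [neg_log_le_pbar_cantorExponent h hc hcuv]

lemma abs_sub_rpow_pbar_le {u v : ℝ} (h : u < v) :
    |cantorCompl v / Real.exp 1 - cantorCompl u / Real.exp 1| ^ pbar cantorExponent u v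
      ≤ v - u := by
  have hzero : (0 : ℝ) ^ pbar cantorExponent u v ≤ v - u := by
    rw [Real.zero_rpow (pbar_cantorExponent_pos h).ne']
    exact (sub_pos.2 h).le
  have habs : |1 / Real.exp 1| = 1 / Real.exp 1 := abs_of_pos (by positivity)
  by_cases hu : u ∈ cantorSet <;> by_cases hv : v ∈ cantorSet
  · simpa [cantorCompl_of_mem hu, cantorCompl_of_mem hv] using hzero
  · rw [cantorCompl_of_mem hu, cantorCompl_of_notMem hv, zero_div, sub_zero, habs]
    exact exp_neg_one_rpow_pbar_le h hu (left_mem_Icc.2 h.le)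
  · rw [cantorCompl_of_notMem hu, cantorCompl_of_mem hv, zero_div, zero_sub, abs_neg, habs]
    exact exp_neg_one_rpow_pbar_le h hv (right_mem_Icc.2 h.le)
  · simpa [cantorCompl_of_notMem hu, cantorCompl_of_notMem hv] using hzero

lemma memWBV_cantorCompl : MemWBV cantorExponent cantorCompl 0 1 := by
  refine ⟨cantorCompl_of_mem zero_mem_cantorSet, ?_⟩
  have hvar : wienerVar cantorExponent (fun x => cantorCompl x / Real.exp 1) 0 1 ≤ 1 := by
    refine iSup_le fun n => iSup_le fun t => iSup_le fun ht => ?_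
    rw [← ENNReal.ofReal_one]
    refine ENNReal.ofReal_le_ofReal ?_
    calc _ ≤ ∑ k ∈ Finset.range n, (t (k + 1) - t k) :=
          Finset.sum_le_sum fun k hk =>
            abs_sub_rpow_pbar_le (ht.2.2.2 k (Finset.mem_range.1 hk))
      _ = 1 := by rw [Finset.sum_range_sub, ht.2.1, ht.2.2.1, sub_zero]
  exact (iInf_le_of_le (Real.exp 1) <| iInf_le_of_le (Real.exp_pos 1) <|
    iInf_le_of_le hvar le_rfl).trans_lt ENNReal.ofReal_lt_top

lemma not_continuousWithinAt_cantorCompl {x : ℝ} (hx : x ∈ cantorSet) :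
    ¬ ContinuousWithinAt cantorCompl (Icc 0 1) x := by
  intro hcont
  have hev : ∀ᶠ y in nhdsWithin x (Icc 0 1), cantorCompl y < 1 :=
    hcont.eventually (gt_mem_nhds (by rw [cantorCompl_of_mem hx]; exact one_pos))
  obtain ⟨U, hU, hxU, hUsub⟩ := mem_nhdsWithin.1 hev
  have hxcl : x ∈ closure (Ioo (0 : ℝ) 1) := by
    rw [closure_Ioo zero_ne_one]
    exact cantorSet_subset_unitInterval hx
  have hne : (U ∩ Ioo 0 1).Nonempty := mem_closure_iff.1 hxcl U hU hxU
  refine ((hU.inter isOpen_Ioo).measure_pos volume hne).ne' (measure_mono_null ?_ volume_cantorSet)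
  intro y hy
  by_contra hyC
  have : cantorCompl y < 1 := hUsub ⟨hy.1, Ioo_subset_Icc_self hy.2⟩
  rw [cantorCompl_of_notMem hyC] at this
  exact lt_irrefl _ this

/-- there are an integrable, essentially unbounded exponent `p` on `[0,1]`
and `f ∈ WBV_{p(·)}[0,1]` whose set of discontinuity points is uncountable. -/
theorem exists_unbounded_exponent_uncountable_discontinuities :
    ∃ p f : ℝ → ℝ,
      (∀ x ∈ Set.Icc (0 : ℝ) 1, 1 ≤ p x) ∧
      MeasureTheory.IntegrableOn p (Set.Icc (0 : ℝ) 1) ∧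
      (¬ ∃ M : ℝ, ∀ᵐ x ∂(volume.restrict (Set.Icc (0 : ℝ) 1)), p x ≤ M) ∧
      MemWBV p f 0 1 ∧
      ¬ {x ∈ Set.Icc (0 : ℝ) 1 | ¬ ContinuousWithinAt f (Set.Icc (0 : ℝ) 1) x}.Countable := by
  refine ⟨cantorExponent, cantorCompl, fun x _ => one_le_cantorExponent x,
    integrableOn_cantorExponent, not_ae_bdd_cantorExponent, memWBV_cantorCompl, fun h => ?_⟩
  refine not_countable_cantorSet (h.mono fun x hx => ?_)
  exact ⟨cantorSet_subset_unitInterval hx, not_continuousWithinAt_cantorCompl hx⟩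
end

section
/- Let a < b be reals and let p : [a,b] → [1,∞) be Lebesgue integrable. Then the following are equivalent: (i) 1 < inf{p̄(Q) : Q = [u,v] ⊆ [a,b], u < v} and sup{p̄(Q) : Q = [u,v] ⊆ [a,b], u < v} < ∞; (ii) 1 < essinf_{[a,b]} p and esssup_{[a,b]} p < ∞. -/
open MeasureTheory Set Filter
open scoped ENNReal

lemma ae_nonneg_of_intervalIntegral_nonneg {a b : ℝ} (hab : a < b) {g : ℝ → ℝ}
    (hg : IntervalIntegrable g volume a b)
    (h : ∀ u v : ℝ, a ≤ u → u < v → v ≤ b → 0 ≤ ∫ t in u..v, g t) :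
    ∀ᵐ x ∂(volume.restrict (Set.Icc a b)), 0 ≤ g x := by
  have hsub : ∀ x ∈ Icc a b, IntervalIntegrable g volume a x := fun x hx =>
    hg.mono_set (uIcc_subset_uIcc_left (by rwa [uIcc_of_le hab.le]))
  have hmono : MonotoneOn (fun x => ∫ t in a..x, g t) (Icc a b) := by
    intro x hx y hy hxy
    rcases hxy.eq_or_lt with rfl | hlt
    · exact le_rfl
    have hpos := h x y hx.1 hlt hy.2
    rw [← intervalIntegral.integral_interval_sub_left (hsub y hy) (hsub x hx)] at hpos
    exact sub_nonneg.mp hpos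
  rw [ae_restrict_iff' measurableSet_Icc]
  filter_upwards [hg.ae_hasDerivAt_integral] with x hx hxab
  rw [uIcc_of_le hab.le] at hx
  have hd := hx hxab a (left_mem_Icc.mpr hab.le)
  exact hd.hasDerivWithinAt.nonneg_of_monotoneOn
    ((uniqueDiffOn_Icc hab x hxab).accPt) hmono

lemma le_average_iff_ae_le {a b : ℝ} (hab : a < b) {g : ℝ → ℝ}
    (hg : IntervalIntegrable g volume a b) (c : ℝ) :
    (∀ u v : ℝ, a ≤ u → u < v → v ≤ b → c ≤ (v - u)⁻¹ * ∫ t in u..v, g t) ↔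
      ∀ᵐ x ∂(volume.restrict (Set.Icc a b)), c ≤ g x := by
  have hsub : ∀ u v : ℝ, a ≤ u → u < v → v ≤ b → IntervalIntegrable g volume u v :=
    fun u v hu huv hv => hg.mono_set <| by
      rw [uIcc_of_le hab.le, uIcc_of_le huv.le]
      exact Icc_subset_Icc hu hv
  constructor
  · intro h
    have key := ae_nonneg_of_intervalIntegral_nonneg hab
      (hg.sub (intervalIntegrable_const (c := c))) fun u v hu huv hv => by
        rw [intervalIntegral.integral_sub (hsub u v hu huv hv) intervalIntegrable_const,
          intervalIntegral.integral_const, smul_eq_mul, sub_nonneg]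
        exact (le_inv_mul_iff₀ (sub_pos.mpr huv)).mp (h u v hu huv hv)
    filter_upwards [key] with x hx using sub_nonneg.mp hx
  · intro h u v hu huv hv
    rw [le_inv_mul_iff₀ (sub_pos.mpr huv), ← smul_eq_mul, ← intervalIntegral.integral_const]
    exact intervalIntegral.integral_mono_ae_restrict huv.le intervalIntegrable_const
      (hsub u v hu huv hv) (ae_restrict_of_ae_restrict_of_subset (Icc_subset_Icc hu hv) h)

lemma average_le_iff_ae_le {a b : ℝ} (hab : a < b) {g : ℝ → ℝ}
    (hg : IntervalIntegrable g volume a b) (c : ℝ) :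
    (∀ u v : ℝ, a ≤ u → u < v → v ≤ b → (v - u)⁻¹ * ∫ t in u..v, g t ≤ c) ↔
      ∀ᵐ x ∂(volume.restrict (Set.Icc a b)), g x ≤ c := by
  simpa using le_average_iff_ae_le hab hg.neg (-c)

section Exponent

variable {a b : ℝ} {p : ℝ → ℝ}

lemma intervalIntegrable_inv_of_one_le (hab : a < b) (hp1 : ∀ x ∈ Set.Icc a b, 1 ≤ p x)
    (hp : AEStronglyMeasurable p (volume.restrict (Set.Icc a b))) :
    IntervalIntegrable (fun x => (p x)⁻¹) volume a b := by
  rw [intervalIntegrable_iff_integrableOn_Icc_of_le hab.le]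
  refine Integrable.of_bound hp.aemeasurable.inv.aestronglyMeasurable 1 ?_
  filter_upwards [ae_restrict_mem measurableSet_Icc] with x hx
  rw [norm_inv, Real.norm_of_nonneg (zero_le_one.trans (hp1 x hx))]
  exact inv_le_one_of_one_le₀ (hp1 x hx)

lemma average_inv_pos (hab : a < b) (hp1 : ∀ x ∈ Set.Icc a b, 1 ≤ p x)
    (hp : IntervalIntegrable (fun x => (p x)⁻¹) volume a b) {u v : ℝ}
    (hu : a ≤ u) (huv : u < v) (hv : v ≤ b) :
    0 < (v - u)⁻¹ * ∫ t in u..v, (p t)⁻¹ := by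
  refine mul_pos (inv_pos.mpr (sub_pos.mpr huv)) ?_
  refine intervalIntegral.intervalIntegral_pos_of_pos_on (hp.mono_set ?_) (fun x hx => ?_) huv
  · rw [uIcc_of_le hab.le, uIcc_of_le huv.le]
    exact Icc_subset_Icc hu hv
  · exact inv_pos.mpr (one_pos.trans_le (hp1 x ⟨hu.trans hx.1.le, hx.2.le.trans hv⟩))

lemma le_pbar_iff_ae_le (hab : a < b) (hp1 : ∀ x ∈ Set.Icc a b, 1 ≤ p x)
    (hp : IntervalIntegrable (fun x => (p x)⁻¹) volume a b) {m : ℝ} (hm : 0 < m) :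
    (∀ u v : ℝ, a ≤ u → u < v → v ≤ b → m ≤ pbar p u v) ↔
      ∀ᵐ x ∂(volume.restrict (Set.Icc a b)), m ≤ p x := by
  trans ∀ᵐ x ∂(volume.restrict (Set.Icc a b)), (p x)⁻¹ ≤ m⁻¹
  · rw [← average_le_iff_ae_le hab hp]
    refine forall₅_congr fun u v hu huv hv => ?_
    exact le_inv_comm₀ hm (average_inv_pos hab hp1 hp hu huv hv)
  · refine eventually_congr ?_
    filter_upwards [ae_restrict_mem measurableSet_Icc] with x hx
    exact inv_le_inv₀ (one_pos.trans_le (hp1 x hx)) hm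

lemma pbar_le_iff_ae_le (hab : a < b) (hp1 : ∀ x ∈ Set.Icc a b, 1 ≤ p x)
    (hp : IntervalIntegrable (fun x => (p x)⁻¹) volume a b) {M : ℝ} (hM : 0 < M) :
    (∀ u v : ℝ, a ≤ u → u < v → v ≤ b → pbar p u v ≤ M) ↔
      ∀ᵐ x ∂(volume.restrict (Set.Icc a b)), p x ≤ M := by
  trans ∀ᵐ x ∂(volume.restrict (Set.Icc a b)), M⁻¹ ≤ (p x)⁻¹
  · rw [← le_average_iff_ae_le hab hp]
    refine forall₅_congr fun u v hu huv hv => ?_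
    exact inv_le_comm₀ (average_inv_pos hab hp1 hp hu huv hv) hM
  · refine eventually_congr ?_
    filter_upwards [ae_restrict_mem measurableSet_Icc] with x hx
    exact inv_le_inv₀ hM (one_pos.trans_le (hp1 x hx))

end Exponent

/-- `1 < inf p̄(Q)` and `sup p̄(Q) < ∞` (over subintervals `Q ⊆ [a,b]`)
iff `1 < essinf p` and `esssup p < ∞` on `[a,b]`. -/
theorem pbar_bounds_iff_essential_bounds (a b : ℝ) (hab : a < b) (p : ℝ → ℝ)
    (hp1 : ∀ x ∈ Set.Icc a b, 1 ≤ p x)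
    (hpint : MeasureTheory.IntegrableOn p (Set.Icc a b)) :
    ((∃ m : ℝ, 1 < m ∧ ∀ u v : ℝ, a ≤ u → u < v → v ≤ b → m ≤ pbar p u v) ∧
     (∃ M : ℝ, ∀ u v : ℝ, a ≤ u → u < v → v ≤ b → pbar p u v ≤ M)) ↔
    ((∃ m : ℝ, 1 < m ∧ ∀ᵐ x ∂(volume.restrict (Set.Icc a b)), m ≤ p x) ∧
     (∃ M : ℝ, ∀ᵐ x ∂(volume.restrict (Set.Icc a b)), p x ≤ M)) := by
  have hp := intervalIntegrable_inv_of_one_le hab hp1 hpint.aestronglyMeasurable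
  refine and_congr (exists_congr fun m => and_congr_right fun hm =>
    le_pbar_iff_ae_le hab hp1 hp (one_pos.trans hm)) ⟨?_, ?_⟩
  · rintro ⟨M, hM⟩
    refine ⟨max M 1, (pbar_le_iff_ae_le hab hp1 hp (by positivity)).mp ?_⟩
    exact fun u v hu huv hv => (hM u v hu huv hv).trans (le_max_left M 1)
  · rintro ⟨M, hM⟩
    refine ⟨max M 1, (pbar_le_iff_ae_le hab hp1 hp (by positivity)).mpr ?_⟩
    filter_upwards [hM] with x hx using hx.trans (le_max_left M 1)
end
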